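/- arXiv:2309.11185 — 3 statements merged into one kernel-verified Lean document; each statement's English description precedes it below -/
import Mathlib

section
/- For every τ ∈ [0,1], every even integer N ≥ 2 and every integer p ≥ 10, the spectral moments satisfy the 11-term recurrence 2(2p+1)(1−τ)⁶·M_{2p,τ} = Σ_{l=1}^{10} 𝔄_l(p;τ)·M_{2p−2l,τ}, where 𝔄_l(p;τ) = [1/((1+6τ+2N(1−τ²))·(4+17τ+6τ²+2N(1−τ²))²)] · [1/(256(p−4)(p−3)(p−2))] · Σ_{k=0}^{min(10−l,7)} (2p−k−2l+1)_{k+2l−3} · 𝔞_{k,k+2l−3}, with (a)_n = a(a+1)⋯(a+n−1) the Pochhammer symbol and 𝔞_{k,j} the coefficient of t^j in the polynomial A_k(t). -/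
open Real MeasureTheory Finset

/-- The rescaled (monic-type) Hermite polynomials `C_k` with parameter `τ`:
`C_0(x) = 1`, `C_1(x) = x`, `C_{k+1}(x) = x·C_k(x) − k·τ·C_{k−1}(x)`. -/
noncomputable def CH (τ : ℝ) : ℕ → ℝ → ℝ
  | 0 => fun _ => 1
  | 1 => fun x => x
  | (k+2) => fun x => x * CH τ (k+1) x - ((k : ℝ) + 1) * τ * CH τ k x

/-- The elliptic GinUE part `R_N^{(1)}` of the real-eigenvalue density. -/
noncomputable def R1 (τ : ℝ) (N : ℕ) (x : ℝ) : ℝ :=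
  (Real.exp (-x^2/(1+τ)) / Real.sqrt (2*Real.pi)) *
    ∑ k ∈ Finset.range (N-1), (CH τ k x)^2 / (Nat.factorial k : ℝ)

/-- The correction part `R_N^{(2)}` of the real-eigenvalue density. -/
noncomputable def R2 (τ : ℝ) (N : ℕ) (x : ℝ) : ℝ :=
  (1/((1+τ) * (Nat.factorial (N-2) : ℝ))) * (Real.exp (-x^2/(2*(1+τ))) / Real.sqrt (2*Real.pi)) *
    CH τ (N-1) x * (∫ u in (0:ℝ)..x, Real.exp (-u^2/(2*(1+τ))) * CH τ (N-2) u)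

/-- The density `R_N` of real eigenvalues of the elliptic GinOE. -/
noncomputable def Rd (τ : ℝ) (N : ℕ) (x : ℝ) : ℝ := R1 τ N x + R2 τ N x

/-- The moment generating function of real eigenvalues of the elliptic GinOE. -/
noncomputable def MGF (τ : ℝ) (N : ℕ) (t : ℝ) : ℝ := ∫ x : ℝ, Real.exp (t*x) * Rd τ N x

/-- The `p`-th spectral moment of real eigenvalues of the elliptic GinOE. -/
noncomputable def Mom (τ : ℝ) (N : ℕ) (p : ℕ) : ℝ := ∫ x : ℝ, x^p * Rd τ N x

/-- The elliptic GinUE part `u` of the moment generating function. -/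
noncomputable def uF (τ : ℝ) (N : ℕ) (t : ℝ) : ℝ := ∫ x : ℝ, Real.exp (t*x) * R1 τ N x

/-- The part `v` of the moment generating function coming from `R_N^{(2)}`. -/
noncomputable def vF (τ : ℝ) (N : ℕ) (t : ℝ) : ℝ := ∫ x : ℝ, Real.exp (t*x) * R2 τ N x

open Polynomial in
/-- The polynomial `a(t)`. -/
noncomputable def pa (τ Nr : ℝ) : Polynomial ℝ :=
  C (-2*τ^2*(1+τ)^3*(1+2*τ)) * X^6
  + C (4*τ*(1+τ)^2*(1+8*τ-5*τ*(1-τ^2)*Nr)) * X^4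
  + C (8*(1-τ^2)*(1-3*τ-30*τ^2+(1-τ^2)*(3+4*τ+4*τ^2)*Nr+2*(1-τ^2)^2*Nr^2)) * X^2
  + C (32*(1-τ)^2*(1+6*τ+2*(1-τ^2)*Nr))

open Polynomial in
/-- The polynomial `b(t)`. -/
noncomputable def pb (τ Nr : ℝ) : Polynomial ℝ :=
  C (-2*τ*(1+τ)^2*(1-τ-6*τ^2)) * X^5
  + C (4*(1-τ^2)*((1-2*τ)*(1+7*τ)+2*(1-τ)^3*(1+τ)*Nr)) * X^3
  - C (32*(1-τ)^2*(1+6*τ+2*(1-τ^2)*Nr)) * X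

open Polynomial in
/-- The polynomial `c(t)`. -/
noncomputable def pc (τ Nr : ℝ) : Polynomial ℝ :=
  C (4*τ*(1-τ^2)*(1+2*τ)) * X^4 - C (8*(1-τ)^2*(1+6*τ+2*Nr*(1-τ^2))) * X^2

open Polynomial in
/-- The polynomial `d(t)`. -/
noncomputable def pd (τ Nr : ℝ) : Polynomial ℝ :=
  C (τ*(1+τ)*(2+τ)*(1+2*τ)) * X^5 - C (2*(1-τ)*(4+17*τ+6*τ^2+2*Nr*(1-τ^2))) * X^3

open Polynomial in
/-- The polynomial `q(t) = 2τ(1+τ)(4−τ)t² − 4(1−τ)`. -/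
noncomputable def pq (τ : ℝ) : Polynomial ℝ :=
  C (2*τ*(1+τ)*(4-τ)) * X^2 - C (4*(1-τ))

open Polynomial in
/-- `t·β_{k,j}(t)`, the numerators (after multiplying by `t`) of the rational functions
`β_{k,j}` from the paper; each is a genuine polynomial. -/
noncomputable def tβ (τ Nr : ℝ) : ℕ → ℕ → Polynomial ℝ
  | 4, 0 => C (4*(1-τ)) * pc τ Nr * X
  | 3, 0 => C (4*(1-τ)) * (pb τ Nr + C 2 * derivative (pc τ Nr)) * X + pq τ * pc τ Nr
  | 3, 1 => -(C (8*(1-τ)) * pc τ Nr * X)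
  | 2, 0 => C (4*(1-τ)) * (pa τ Nr + C 2 * derivative (pb τ Nr)
              + derivative (derivative (pc τ Nr))) * X
            + pq τ * (pb τ Nr + derivative (pc τ Nr)) + C (3*τ^2*(1+τ)^2) * X^3 * pc τ Nr
  | 2, 1 => -(C (8*(1-τ)) * (pb τ Nr + derivative (pc τ Nr)) * X) - pq τ * pc τ Nr
  | 2, 2 => -(C (4*(1-τ)) * pc τ Nr * X)
  | 2, 3 => C (8*(1-τ)) * pc τ Nr * X
  | 1, 0 => C (4*(1-τ)) * (C 2 * derivative (pa τ Nr)
              + derivative (derivative (pb τ Nr))) * X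
            + pq τ * (pa τ Nr + derivative (pb τ Nr)) + C (3*τ^2*(1+τ)^2) * X^3 * pb τ Nr
  | 1, 1 => -(C (8*(1-τ)) * (pa τ Nr + derivative (pb τ Nr)) * X) - pq τ * pb τ Nr
  | 1, 2 => -(C (4*(1-τ)) * pb τ Nr * X)
  | 1, 3 => C (8*(1-τ)) * pb τ Nr * X
  | 0, 0 => C (4*(1-τ)) * derivative (derivative (pa τ Nr)) * X + pq τ * derivative (pa τ Nr)
            + C (3*τ^2*(1+τ)^2) * X^3 * pa τ Nr - C (4*Nr*τ^2*(1+τ)^5) * X^2 * pd τ Nr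
  | 0, 1 => -(C (8*(1-τ)) * derivative (pa τ Nr) * X) - pq τ * pa τ Nr
  | 0, 2 => -(C (4*(1-τ)) * pa τ Nr * X)
  | 0, 3 => C (8*(1-τ)) * pa τ Nr * X
  | _, _ => 0

open Polynomial in
/-- The polynomial `B_k(t) = t⁻⁴(β_{k,0}d² + β_{k,1}dd′ + β_{k,2}dd″ + β_{k,3}d′²)`,
realised as exact division by `t⁵` of the numerator `t·(…)`. -/
noncomputable def Bpoly (τ Nr : ℝ) (k : ℕ) : Polynomial ℝ :=
  (tβ τ Nr k 0 * (pd τ Nr)^2 + tβ τ Nr k 1 * pd τ Nr * derivative (pd τ Nr)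
    + tβ τ Nr k 2 * pd τ Nr * derivative (derivative (pd τ Nr))
    + tβ τ Nr k 3 * (derivative (pd τ Nr))^2) /ₘ X^5

open Polynomial in
/-- The polynomial coefficients `α_{k,j}(t)`. -/
noncomputable def alph (τ Nr : ℝ) : ℕ → ℕ → Polynomial ℝ
  | 7, 4 => C ((1-τ)/2)
  | 6, 4 => C (-((1+τ)*(τ^2-3*τ+1)/2)) * X
  | 6, 3 => C ((1-τ)/2)
  | 5, 4 => -(C ((1+τ)/2) * (C (2*τ*(1-τ^2)) * X^2 + C ((1-τ^2)*Nr + 5 - 15*τ + 6*τ^2)))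
  | 5, 3 => C (-((1+τ)*(τ^2-3*τ+1)/2)) * X
  | 5, 2 => C ((1-τ)/2)
  | 4, 4 => -(C (τ*(1+τ)^2/2) * (C (τ*(1+τ)) * X^2 + C ((1+τ)*Nr + 18 - 19*τ)) * X)
  | 4, 3 => -(C ((1+τ)/2) * (C (2*τ*(1-τ^2)) * X^2 + C ((1-τ^2)*Nr + 4 - 12*τ + 5*τ^2)))
  | 4, 2 => C (-((1+τ)*(τ^2-3*τ+1)/2)) * X
  | 4, 1 => C ((1-τ)/2)
  | 3, 4 => -(C (2*τ*(1+τ)^2) * (C (3*τ*(1+τ)) * X^2 + C ((1+τ)*Nr + 8 - 9*τ)))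
  | 3, 3 => -(C (τ*(1+τ)^2/2) * (C (τ*(1+τ)) * X^2 + C ((1+τ)*Nr + 14 - 15*τ)) * X)
  | 3, 2 => -(C ((1+τ)/2) * (C (2*τ*(1-τ^2)) * X^2 + C ((1-τ^2)*Nr + 3 - 9*τ + 4*τ^2)))
  | 3, 1 => C (-((1+τ)*(τ^2-3*τ+1)/2)) * X
  | 3, 0 => C ((1-τ)/2)
  | 2, 4 => C (-18*τ^2*(1+τ)^3) * X
  | 2, 3 => -(C (3*τ*(1+τ)^2/2) * (C (3*τ*(1+τ)) * X^2 + C ((1+τ)*Nr + 6 - 7*τ)))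
  | 2, 2 => -(C (τ*(1+τ)^2/2) * (C (τ*(1+τ)) * X^2 + C ((1+τ)*Nr + 10 - 11*τ)) * X)
  | 2, 1 => -(C ((1+τ)/2) * (C (2*τ*(1-τ^2)) * X^2 + C ((1-τ^2)*Nr + 2 - 6*τ + 3*τ^2)))
  | 2, 0 => C (-((1+τ)*(τ^2-3*τ+1)/2)) * X
  | 1, 4 => C (-12*τ^2*(1+τ)^3)
  | 1, 3 => C (-9*τ^2*(1+τ)^3) * X
  | 1, 2 => -(C (τ*(1+τ)^2) * (C (3*τ*(1+τ)) * X^2 + C ((1+τ)*Nr + 4 - 5*τ)))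
  | 1, 1 => -(C (τ*(1+τ)^2/2) * (C (τ*(1+τ)) * X^2 + C ((1+τ)*Nr + 6 - 7*τ)) * X)
  | 1, 0 => -(C ((1-τ^2)/2) * (C (2*τ*(1+τ)) * X^2 + C ((1+τ)*Nr + 1 - 2*τ)))
  | 0, 3 => C (-3*τ^2*(1+τ)^3)
  | 0, 2 => C (-3*τ^2*(1+τ)^3) * X
  | 0, 1 => -(C (τ*(1+τ)^2/2) * (C (3*τ*(1+τ)) * X^2 + C ((1+τ)*Nr + 2 - 3*τ)))
  | 0, 0 => -(C (τ*(1+τ)^2/2) * (C (τ*(1+τ)) * X^2 + C ((1+τ)*Nr + 2 - 3*τ)) * X)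
  | _, _ => 0

/-- The polynomial `A_k(t) = Σ_{j=0}^{4} α_{k,j}(t)·B_j(t)`. -/
noncomputable def Apoly (τ Nr : ℝ) (k : ℕ) : Polynomial ℝ :=
  ∑ j ∈ Finset.range 5, alph τ Nr k j * Bpoly τ Nr j

/-- The Pochhammer symbol `(a)_n = a(a+1)⋯(a+n−1)`, extended by `0` to negative
integer indices (such indices only occur multiplied by a vanishing coefficient). -/
noncomputable def poch (a : ℝ) (n : ℤ) : ℝ :=
  if 0 ≤ n then (ascPochhammer ℝ n.toNat).eval a else 0

/-- `𝔞_{k,j}`: the coefficient of `t^j` in the polynomial `A_k(t)` (zero for `j < 0`). -/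
noncomputable def frakCoeff (τ Nr : ℝ) (k : ℕ) (j : ℤ) : ℝ :=
  if 0 ≤ j then (Apoly τ Nr k).coeff j.toNat else 0

/-- The coefficient `𝔄_l(p;τ)` of the 11-term recurrence. -/
noncomputable def frakA (τ Nr : ℝ) (p l : ℕ) : ℝ :=
  (1 / ((1 + 6*τ + 2*Nr*(1-τ^2)) * (4 + 17*τ + 6*τ^2 + 2*Nr*(1-τ^2))^2)) *
  (1 / (256*((p:ℝ)-4)*((p:ℝ)-3)*((p:ℝ)-2))) *
  ∑ k ∈ Finset.range (min (10 - l) 7 + 1),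
    poch (2*(p:ℝ) - (k:ℝ) - 2*(l:ℝ) + 1) ((k:ℤ) + 2*(l:ℤ) - 3) *
      frakCoeff τ Nr k ((k:ℤ) + 2*(l:ℤ) - 3)

section Algebra
variable {A R : Type*} [CommRing A] [CommRing R] [Algebra A R] (D : Derivation A R R)
  {τ N t u X Z V V₂ : R}

theorem derivation_ofNat (n : ℕ) [n.AtLeastTwo] : D (ofNat(n) : R) = 0 :=
  D.map_natCast n

theorem bilinear_eliminate (hτ : D τ = 0) (hN : D N = 0) (ht : D t = 1)
    (hX : 2 * D X = (1 + τ) * t * (X + (N - 1) * u))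
    (hY : (1 - τ) * (u + t * D u) =
      (1 + τ) * (2 * X - τ * t ^ 2 * u - 2 * τ * (N - 1) * Z))
    (hZ : 2 * D Z = (1 + τ) * t * (u - τ * Z)) :
    2 * (1 + τ) ^ 3 * τ * (N - 1) * t * Z =
      2 * (1 - τ) * (2 * D u + t * D (D u))
        - (1 + τ) * t * ((1 - τ) * (u + t * D u) + (1 + τ) * τ * t ^ 2 * u)
        + (-2 * (1 + τ) ^ 2 * t * (N - 1) + 4 * (1 + τ) * τ * t
          + 2 * (1 + τ) ^ 2 * τ * (N - 1) * t) * u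
        + 2 * (1 + τ) * τ * t ^ 2 * D u := by
  have hY' := congrArg D hY
  simp only [map_add, map_sub, Derivation.leibniz,
    Derivation.leibniz_pow, smul_eq_mul, hτ, hN, ht, derivation_ofNat, Derivation.map_one_eq_zero,
    nsmul_eq_mul, mul_zero, add_zero, sub_zero, mul_one,
    Nat.cast_ofNat, Nat.add_one_sub_one, pow_one] at hY'
  linear_combination (-2) * hY' - 2 * (1+τ)*hX + 2*(1+τ)*τ*(N-1)*hZ + (1+τ)*t*hY

theorem third_order_ode (hτ : D τ = 0) (hN : D N = 0) (ht : D t = 1)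
    (hX : 2 * D X = (1 + τ) * t * (X + (N - 1) * u))
    (hY : (1 - τ) * (u + t * D u) =
      (1 + τ) * (2 * X - τ * t ^ 2 * u - 2 * τ * (N - 1) * Z))
    (hZ : 2 * D Z = (1 + τ) * t * (u - τ * Z)) :
    4 * (1 - τ) * t ^ 2 * D (D (D u))
      + (8 * (1 - τ) * t + (-2 + 6 * τ + 6 * τ ^ 2 - 2 * τ ^ 3) * t ^ 3) * D (D u)
      + (-8 * (1 - τ)
        + (-4 * N + 20 * τ - 4 * N * τ + 12 * τ ^ 2 + 4 * N * τ ^ 2 - 8 * τ ^ 3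
          + 4 * N * τ ^ 3) * t ^ 2
        - 3 * τ * (1 - τ) * (1 + τ) ^ 2 * t ^ 4) * D u
      + (1 + τ) ^ 2 * τ * ((-1 - 4 * N + 9 * τ - 4 * N * τ) * t ^ 3
        - τ * (1 + τ) * t ^ 5) * u = 0 := by
  have hS := bilinear_eliminate D hτ hN ht hX hY hZ
  have hS' := congrArg D hS
  simp only [map_add, map_sub, map_neg, Derivation.leibniz,
    Derivation.leibniz_pow, smul_eq_mul, hτ, hN, ht, derivation_ofNat, Derivation.map_one_eq_zero,
    nsmul_eq_mul, mul_zero, add_zero, zero_add, sub_zero, neg_zero, mul_one,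
    Nat.cast_ofNat, Nat.add_one_sub_one, pow_one] at hS'
  linear_combination (-2) * t * hS' + (2 - (1+τ)*τ*t^2) * hS + 2*(1+τ)^3*τ*(N-1)*t^2 * hZ

theorem correction_ode (hτ : D τ = 0) (hN : D N = 0) (ht : D t = 1)
    (hV : 2 * D V = (1 + τ) * (2 * t * V + 2 * (N - 1) * V₂ + t * u))
    (hV₂ : D V₂ = (1 + τ) * (V - τ * Z - τ * t * V₂)) :
    2 * (D (D V) - (1 + τ) * (1 - τ) * t * D V
        - (1 + τ) * (1 + (1 + τ) * (N - 1) + (1 + τ) * τ * t ^ 2) * V) =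
      (1 + τ) * (u + t * D u) + (1 + τ) ^ 2 * τ * t ^ 2 * u
        - 2 * (1 + τ) ^ 2 * τ * (N - 1) * Z := by
  have hV' := congrArg D hV
  simp only [map_add, map_sub, Derivation.leibniz,
    smul_eq_mul, hτ, hN, ht, derivation_ofNat, Derivation.map_one_eq_zero,
    mul_zero, add_zero, sub_zero, mul_one] at hV'
  linear_combination hV' + 2*(1+τ)*(N-1)*hV₂ + (1+τ)*τ*t*hV

theorem density_third_order [IsDomain R] [CharZero R] (hτ : D τ = 0) (hN : D N = 0) (ht : D t = 1)
    (hX : 2 * D X = (1 + τ) * t * (X + (N - 1) * u))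
    (hY : (1 - τ) * (u + t * D u) =
      (1 + τ) * (2 * X - τ * t ^ 2 * u - 2 * τ * (N - 1) * Z))
    (hZ : 2 * D Z = (1 + τ) * t * (u - τ * Z))
    (hV : 2 * D V = (1 + τ) * (2 * t * V + 2 * (N - 1) * V₂ + t * u))
    (hV₂ : D V₂ = (1 + τ) * (V - τ * Z - τ * t * V₂))
    {M W : R} (hM : M = u + V)
    (hW : 2 * W = (1 - τ) * D (D (D M)) - (1 + τ) * (τ ^ 2 - 3 * τ + 1) * t * D (D M)
      - (1 - τ ^ 2) * (2 * τ * (1 + τ) * t ^ 2 + (1 + τ) * N + 1 - 2 * τ) * D M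
      - τ * (1 + τ) ^ 2 * (τ * (1 + τ) * t ^ 2 + (1 + τ) * N + 2 - 3 * τ) * t * M) :
    4 * (1 - τ) * t * D (D u) + (2 * τ * (1 + τ) * (4 - τ) * t ^ 2 - 4 * (1 - τ)) * D u
      + 3 * τ ^ 2 * (1 + τ) ^ 2 * t ^ 3 * u = -4 * t ^ 2 * W := by
  have hS := bilinear_eliminate D hτ hN ht hX hY hZ
  have hE := third_order_ode D hτ hN ht hX hY hZ
  have hC := correction_ode D hτ hN ht hV hV₂
  have hC' := congrArg D hC
  subst hM
  simp only [map_add, map_sub, Derivation.leibniz,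
    Derivation.leibniz_pow, smul_eq_mul, hτ, hN, ht, derivation_ofNat, Derivation.map_one_eq_zero,
    nsmul_eq_mul, mul_zero, add_zero, zero_add, sub_zero, mul_one,
    Nat.cast_ofNat, Nat.add_one_sub_one, pow_one] at hC' hW
  apply mul_left_cancel₀ (two_ne_zero : (2:R) ≠ 0)
  linear_combination 4*t^2*hW + hE + 2*t^2*(1-τ)*hC' + 2*t^2*((1+τ)*τ*t)*hC - 2*(1+τ)^2*τ*(N-1)*t^2*(1-τ)*hZ - (1+τ)*τ*t^2*hS

set_option maxRecDepth 10000 in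
theorem second_order_of_density [IsDomain R] [CharZero R] (hτ : D τ = 0) (hN : D N = 0) (ht : D t = 1) (ht0 : t ≠ 0)
    {W a b c d : R}
    (hE : 4 * (1 - τ) * t ^ 2 * D (D (D u))
      + (8 * (1 - τ) * t + (-2 + 6 * τ + 6 * τ ^ 2 - 2 * τ ^ 3) * t ^ 3) * D (D u)
      + (-8 * (1 - τ)
        + (-4 * N + 20 * τ - 4 * N * τ + 12 * τ ^ 2 + 4 * N * τ ^ 2 - 8 * τ ^ 3
          + 4 * N * τ ^ 3) * t ^ 2
        - 3 * τ * (1 - τ) * (1 + τ) ^ 2 * t ^ 4) * D u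
      + (1 + τ) ^ 2 * τ * ((-1 - 4 * N + 9 * τ - 4 * N * τ) * t ^ 3
        - τ * (1 + τ) * t ^ 5) * u = 0)
    (hI : 4 * (1 - τ) * t * D (D u) + (2 * τ * (1 + τ) * (4 - τ) * t ^ 2 - 4 * (1 - τ)) * D u
      + 3 * τ ^ 2 * (1 + τ) ^ 2 * t ^ 3 * u = -4 * t ^ 2 * W)
    (ha : a = -2*τ^2*(1+τ)^3*(1+2*τ) * t^6
      + 4*τ*(1+τ)^2*(1+8*τ-5*τ*(1-τ^2)*N) * t^4
      + 8*(1-τ^2)*(1-3*τ-30*τ^2+(1-τ^2)*(3+4*τ+4*τ^2)*N+2*(1-τ^2)^2*N^2) * t^2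
      + 32*(1-τ)^2*(1+6*τ+2*(1-τ^2)*N))
    (hb : b = -2*τ*(1+τ)^2*(1-τ-6*τ^2) * t^5
      + 4*(1-τ^2)*((1-2*τ)*(1+7*τ)+2*(1-τ)^3*(1+τ)*N) * t^3
      - 32*(1-τ)^2*(1+6*τ+2*(1-τ^2)*N) * t)
    (hc : c = 4*τ*(1-τ^2)*(1+2*τ) * t^4 - 8*(1-τ)^2*(1+6*τ+2*N*(1-τ^2)) * t^2)
    (hd : d = τ*(1+τ)*(2+τ)*(1+2*τ) * t^5 - 2*(1-τ)*(4+17*τ+6*τ^2+2*N*(1-τ^2)) * t^3) :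
    a * W + b * D W + c * D (D W) = -(N * τ ^ 2 * (1 + τ) ^ 5) * (d * u) := by
  have hE' := congrArg D hE
  have hI' := congrArg D hI
  have hI'' := congrArg D hI'
  simp only [map_add, map_sub, map_neg, map_zero, Derivation.leibniz,
    Derivation.leibniz_pow, smul_eq_mul, hτ, hN, ht, derivation_ofNat, Derivation.map_one_eq_zero,
    nsmul_eq_mul, mul_zero, add_zero, zero_add, sub_zero, neg_zero, mul_one,
    Nat.cast_ofNat, Nat.add_one_sub_one, pow_one] at hE' hI' hI''
  have h0 : 4 * t ^ 4 ≠ 0 := mul_ne_zero (by norm_num) (pow_ne_zero 4 ht0)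
  apply mul_left_cancel₀ h0
  rw [hd]
  linear_combination (norm := skip) t^2 * c * hI'' + (b * t^2 - 4 * c * t) * hI' + (a * t^2 - 2 * b * t + 6 * c) * hI
    - t * c * hE' + t^2 * ((-24 -48*N -96*τ +96*τ*N +264*τ^2 -144*τ^3 -96*τ^3*N +48*τ^4*N)
      + (32*τ+16*τ*N+112*τ^2-8*τ^2*N-32*τ^3-32*τ^3*N-112*τ^4+16*τ^4*N+16*τ^5*N-8*τ^6*N)*t^2
      - (6*τ^2+24*τ^3+30*τ^4+12*τ^5)*t^4) * hE
  rw [ha, hb, hc]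
  ring

theorem fourth_order_of_second_order {W a b c d e k q r : R} (he : D e = 0)
    (hK : a * W + b * D W + c * D (D W) = e * (d * u))
    (hL : 4 * k * t * D (D u) + q * D u + r * t ^ 3 * u = -4 * t ^ 2 * W) :
    (4 * k * c * t * d ^ 2) * D (D (D (D W)))
    + ((4 * k * (b + 2 * D c) * t + q * c) * d ^ 2 - 8 * k * c * t * d * D d) * D (D (D W))
    + ((4 * k * (a + 2 * D b + D (D c)) * t + q * (b + D c) + r * t ^ 3 * c) * d ^ 2
        - (8 * k * (b + D c) * t + q * c) * d * D d - 4 * k * c * t * d * D (D d)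
        + 8 * k * c * t * D d ^ 2) * D (D W)
    + ((4 * k * (2 * D a + D (D b)) * t + q * (a + D b) + r * t ^ 3 * b) * d ^ 2
        - (8 * k * (a + D b) * t + q * b) * d * D d - 4 * k * b * t * d * D (D d)
        + 8 * k * b * t * D d ^ 2) * D W
    + ((4 * k * D (D a) * t + q * D a + r * t ^ 3 * a + 4 * e * t ^ 2 * d) * d ^ 2
        - (8 * k * D a * t + q * a) * d * D d - 4 * k * a * t * d * D (D d)
        + 8 * k * a * t * D d ^ 2) * W = 0 := by
  have hK' := congrArg D hK
  have hK'' := congrArg D hK'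
  simp only [map_add, Derivation.leibniz, smul_eq_mul, he, mul_zero, add_zero] at hK' hK''
  linear_combination d ^ 2 * (4 * k * t) * hK'' + (d ^ 2 * q - 8 * k * t * d * D d) * hK'
    + (d ^ 2 * r * t ^ 3 - d * D d * q - 4 * k * t * d * D (D d) + 8 * k * t * D d ^ 2) * hK
    + e * d ^ 3 * hL
end Algebra

section Shape
open Polynomial

/-- The coefficient of a polynomial at an integer index, zero at negative indices. -/
noncomputable def intCoeff (P : ℝ[X]) (j : ℤ) : ℝ :=
  if 0 ≤ j then P.coeff j.toNat else 0

/-- `P` only involves powers `X ^ j` with `lo ≤ j ≤ hi` and `j ≡ lo` modulo `2`, and `v` is its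
coefficient at `lo`. -/
structure HasShape (P : ℝ[X]) (lo hi : ℤ) (v : ℝ) : Prop where
  supp : ∀ j : ℕ, P.coeff j ≠ 0 → lo ≤ j ∧ (j : ℤ) ≤ hi ∧ Even ((j : ℤ) - lo)
  low : intCoeff P lo = v

@[simp] theorem intCoeff_natCast (P : ℝ[X]) (j : ℕ) : intCoeff P j = P.coeff j := by
  simp [intCoeff]

theorem intCoeff_of_neg (P : ℝ[X]) {j : ℤ} (hj : j < 0) : intCoeff P j = 0 := by
  simp [intCoeff, hj]

theorem intCoeff_add (P Q : ℝ[X]) (j : ℤ) :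
    intCoeff (P + Q) j = intCoeff P j + intCoeff Q j := by
  unfold intCoeff; split_ifs <;> simp

theorem intCoeff_neg (P : ℝ[X]) (j : ℤ) : intCoeff (-P) j = -intCoeff P j := by
  unfold intCoeff; split_ifs <;> simp

namespace HasShape

variable {P Q : ℝ[X]} {lo hi lo' hi' : ℤ} {v w : ℝ}

theorem congr (h : HasShape P lo hi v) (hlo : lo = lo') (hhi : hi ≤ hi') (hv : v = w) :
    HasShape P lo' hi' w := by
  subst hlo hv
  exact ⟨fun j hj => ⟨(h.supp j hj).1, (h.supp j hj).2.1.trans hhi, (h.supp j hj).2.2⟩, h.low⟩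

theorem weaken (h : HasShape P lo hi v) (hlo : lo' < lo) (hhi : hi ≤ hi')
    (hpar : Even (lo - lo')) : HasShape P lo' hi' 0 := by
  refine ⟨fun j hj => ?_, ?_⟩
  · obtain ⟨h1, h2, h3⟩ := h.supp j hj
    refine ⟨by omega, by omega, ?_⟩
    have := h3.add hpar
    rwa [sub_add_sub_cancel] at this
  · rcases lt_or_ge lo' 0 with h0 | h0
    · exact intCoeff_of_neg P h0
    · lift lo' to ℕ using h0
      rw [intCoeff_natCast]
      by_contra hne
      have := (h.supp lo' hne).1
      omega

theorem zero : HasShape 0 lo hi 0 :=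
  ⟨fun j hj => absurd (coeff_zero j) hj, by simp [intCoeff]⟩

theorem monomial (c : ℝ) (n : ℕ) : HasShape (C c * X ^ n) n n c := by
  refine ⟨fun j hj => ?_, by simp⟩
  have : j = n := by
    by_contra hne
    simp [coeff_X_pow, hne] at hj
  simp [this]

theorem const (c : ℝ) : HasShape (C c) 0 0 c := by
  simpa using monomial c 0

theorem X : HasShape (X : ℝ[X]) 1 1 1 := by
  simpa using monomial 1 1

theorem X_pow (n : ℕ) : HasShape (Polynomial.X ^ n : ℝ[X]) n n 1 := by
  simpa using monomial 1 n

theorem add (hP : HasShape P lo hi v) (hQ : HasShape Q lo hi w) :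
    HasShape (P + Q) lo hi (v + w) := by
  refine ⟨fun j hj => ?_, by rw [intCoeff_add, hP.low, hQ.low]⟩
  by_cases h : P.coeff j = 0
  · exact hQ.supp j fun h' => hj (by simp [h, h'])
  · exact hP.supp j h

theorem neg (hP : HasShape P lo hi v) : HasShape (-P) lo hi (-v) :=
  ⟨fun j hj => hP.supp j fun h => hj (by simp [h]), by rw [intCoeff_neg, hP.low]⟩

theorem sub (hP : HasShape P lo hi v) (hQ : HasShape Q lo hi w) :
    HasShape (P - Q) lo hi (v - w) := by
  simpa only [sub_eq_add_neg] using hP.add hQ.neg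

theorem mul (hP : HasShape P lo hi v) (hQ : HasShape Q lo' hi' w) :
    HasShape (P * Q) (lo + lo') (hi + hi') (v * w) := by
  refine ⟨fun j hj => ?_, ?_⟩
  · rw [coeff_mul] at hj
    obtain ⟨⟨i, k⟩, hik, hne⟩ := Finset.exists_ne_zero_of_sum_ne_zero hj
    rw [HasAntidiagonal.mem_antidiagonal] at hik
    obtain ⟨h1, h2, h3⟩ := hP.supp i (left_ne_zero_of_mul hne)
    obtain ⟨h4, h5, h6⟩ := hQ.supp k (right_ne_zero_of_mul hne)
    simp only at hik
    refine ⟨by omega, by omega, ?_⟩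
    have := h3.add h6
    have e : (i : ℤ) - lo + (k - lo') = j - (lo + lo') := by omega
    rwa [e] at this
  · have key : ∀ i k : ℕ, (i : ℤ) + k = lo + lo' → P.coeff i * Q.coeff k ≠ 0 →
        (i : ℤ) = lo ∧ (k : ℤ) = lo' := fun i k hik hne => by
      have h1 := (hP.supp i (left_ne_zero_of_mul hne)).1
      have h4 := (hQ.supp k (right_ne_zero_of_mul hne)).1
      omega
    by_cases h : 0 ≤ lo ∧ 0 ≤ lo'
    · obtain ⟨h, h'⟩ := h
      lift lo to ℕ using h
      lift lo' to ℕ using h'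
      rw [← hP.low, ← hQ.low, ← Nat.cast_add, intCoeff_natCast, intCoeff_natCast, intCoeff_natCast,
        coeff_mul, Finset.sum_eq_single (lo, lo')]
      · rintro ⟨i, k⟩ hik hne
        rw [HasAntidiagonal.mem_antidiagonal] at hik
        simp only at hik
        by_contra h0
        obtain ⟨h1, h2⟩ := key i k (by omega) h0
        exact hne (by simp_all)
      · intro h
        simp at h
    · have hv : v * w = 0 := by
        rcases not_and_or.1 h with h | h
        · rw [← hP.low, intCoeff_of_neg P (not_le.1 h), zero_mul]
        · rw [← hQ.low, intCoeff_of_neg Q (not_le.1 h), mul_zero]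
      rw [hv]
      rcases lt_or_ge (lo + lo') 0 with h0 | h0
      · exact intCoeff_of_neg _ h0
      · rw [intCoeff, if_pos h0, coeff_mul]
        refine Finset.sum_eq_zero fun x hx => ?_
        rw [HasAntidiagonal.mem_antidiagonal] at hx
        by_contra hne
        obtain ⟨h1, h2⟩ := key x.1 x.2 (by omega) hne
        omega

theorem sq (hP : HasShape P lo hi v) : HasShape (P ^ 2) (lo + lo) (hi + hi) (v * v) := by
  simpa only [pow_two] using hP.mul hP

theorem derivative (hP : HasShape P lo hi v) :
    HasShape (derivative P) (lo - 1) (hi - 1) (lo * v) := by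
  refine ⟨fun j hj => ?_, ?_⟩
  · rw [coeff_derivative] at hj
    obtain ⟨h1, h2, h3⟩ := hP.supp (j + 1) (left_ne_zero_of_mul hj)
    push_cast at h1 h2 h3
    refine ⟨by omega, by omega, ?_⟩
    rwa [sub_sub_eq_add_sub]
  · rcases lt_trichotomy lo 0 with h | h | h
    · rw [← hP.low, intCoeff_of_neg P h, intCoeff_of_neg _ (by omega), mul_zero]
    · rw [h, intCoeff_of_neg _ (by omega), Int.cast_zero, zero_mul]
    · obtain ⟨m, rfl⟩ : ∃ m : ℕ, lo = m + 1 := ⟨(lo - 1).toNat, by omega⟩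
      rw [← hP.low, add_sub_cancel_right, intCoeff_natCast, coeff_derivative,
        show (m : ℤ) + 1 = ((m + 1 : ℕ) : ℤ) by push_cast; rfl, intCoeff_natCast]
      push_cast
      ring

theorem X_pow_dvd (hP : HasShape P lo hi v) {n : ℕ} (hn : (n : ℤ) ≤ lo) :
    Polynomial.X ^ n ∣ P := by
  rw [X_pow_dvd_iff]
  intro d hd
  by_contra hne
  have := (hP.supp d hne).1
  omega

theorem X_pow_mul_divByMonic (hP : HasShape P lo hi v) {n : ℕ} (hn : (n : ℤ) ≤ lo) :
    Polynomial.X ^ n * (P /ₘ Polynomial.X ^ n) = P := by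
  obtain ⟨Q, rfl⟩ := hP.X_pow_dvd hn
  rw [mul_divByMonic_cancel_left _ (monic_X_pow n)]

theorem divByMonic_X_pow (hP : HasShape P lo hi v) {n : ℕ} (hn : (n : ℤ) ≤ lo) :
    HasShape (P /ₘ Polynomial.X ^ n) (lo - n) (hi - n) v := by
  obtain ⟨Q, rfl⟩ := hP.X_pow_dvd hn
  rw [mul_divByMonic_cancel_left _ (monic_X_pow n)]
  have hc : ∀ j, (Polynomial.X ^ n * Q).coeff (j + n) = Q.coeff j := fun j => coeff_X_pow_mul Q n j
  refine ⟨fun j hj => ?_, ?_⟩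
  · rw [← hc] at hj
    obtain ⟨h1, h2, h3⟩ := hP.supp _ hj
    push_cast at h1 h2 h3
    refine ⟨by omega, by omega, ?_⟩
    rwa [sub_sub_eq_add_sub]
  · obtain ⟨m, rfl⟩ : ∃ m : ℕ, lo = m + n := ⟨(lo - n).toNat, by omega⟩
    rw [← hP.low, add_sub_cancel_right, ← Nat.cast_add, intCoeff_natCast, intCoeff_natCast, hc]

theorem intCoeff_eq_zero (hP : HasShape P lo hi v) {j : ℤ} (hj : j < lo ∨ hi < j) :
    intCoeff P j = 0 := by
  rcases lt_or_ge j 0 with h | h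
  · exact intCoeff_of_neg P h
  · lift j to ℕ using h
    rw [intCoeff_natCast]
    by_contra hne
    have := hP.supp j hne
    omega

end HasShape
end Shape

section CoefficientShapes
open Polynomial

variable (τ Nr : ℝ)

theorem hasShape_pa : HasShape (pa τ Nr) 0 6 (32 * (1 - τ) ^ 2 * (1 + 6 * τ + 2 * Nr * (1 - τ ^ 2))) :=
  (((((HasShape.monomial _ 6).weaken (by norm_num) (by norm_num) (by decide)).add
    ((HasShape.monomial _ 4).weaken (by norm_num) (by norm_num) (by decide))).add
    ((HasShape.monomial _ 2).weaken (by norm_num) (by norm_num) (by decide))).add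
    ((HasShape.const _).congr rfl (by norm_num) rfl)).congr rfl le_rfl (by ring)

theorem hasShape_pb :
    HasShape (pb τ Nr) 1 5 (-(32 * (1 - τ) ^ 2 * (1 + 6 * τ + 2 * Nr * (1 - τ ^ 2)))) :=
  ((((HasShape.monomial _ 5).weaken (by norm_num) (by norm_num) (by decide)).add
    ((HasShape.monomial _ 3).weaken (by norm_num) (by norm_num) (by decide))).sub
    (((HasShape.const _).mul HasShape.X).congr rfl (by norm_num) rfl)).congr rfl le_rfl (by ring)

theorem hasShape_pc :
    HasShape (pc τ Nr) 2 4 (-(8 * (1 - τ) ^ 2 * (1 + 6 * τ + 2 * Nr * (1 - τ ^ 2)))) :=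
  (((HasShape.monomial _ 4).weaken (by norm_num) (by norm_num) (by decide)).sub
    ((HasShape.monomial _ 2).congr rfl (by norm_num) rfl)).congr rfl le_rfl (by ring)

theorem hasShape_pd :
    HasShape (pd τ Nr) 3 5 (-(2 * (1 - τ) * (4 + 17 * τ + 6 * τ ^ 2 + 2 * Nr * (1 - τ ^ 2)))) :=
  (((HasShape.monomial _ 5).weaken (by norm_num) (by norm_num) (by decide)).sub
    ((HasShape.monomial _ 3).congr rfl (by norm_num) rfl)).congr rfl le_rfl (by ring)

theorem hasShape_pq : HasShape (pq τ) 0 2 (-(4 * (1 - τ))) :=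
  (((HasShape.monomial _ 2).weaken (by norm_num) (by norm_num) (by decide)).sub
    ((HasShape.const _).congr rfl (by norm_num) rfl)).congr rfl le_rfl (by ring)

/-- The numerator of `Bpoly`. -/
noncomputable def Bnumer (k : ℕ) : ℝ[X] :=
  tβ τ Nr k 0 * (pd τ Nr)^2 + tβ τ Nr k 1 * pd τ Nr * derivative (pd τ Nr)
    + tβ τ Nr k 2 * pd τ Nr * derivative (derivative (pd τ Nr))
    + tβ τ Nr k 3 * (derivative (pd τ Nr))^2

/-- The lowest coefficients of the polynomials `Bpoly`, up to a common factor. -/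
noncomputable def Blow : ℕ → ℝ
  | 0 => 60
  | 1 => -60
  | 2 => 21
  | 3 => -1
  | 4 => -1
  | _ => 0

theorem hasShape_numer {β₀ β₁ β₂ β₃ d : ℝ[X]} {lo hi : ℤ} {v₀ v₁ v₂ v₃ δ w : ℝ}
    (h₀ : HasShape β₀ lo hi v₀) (h₁ : HasShape β₁ (lo + 1) (hi + 1) v₁)
    (h₂ : HasShape β₂ (lo + 2) (hi + 2) v₂) (h₃ : HasShape β₃ (lo + 2) (hi + 2) v₃)
    (hd : HasShape d 3 5 δ) (hw : δ ^ 2 * (v₀ + 3 * v₁ + 6 * v₂ + 9 * v₃) = w) :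
    HasShape (β₀ * d ^ 2 + β₁ * d * derivative d + β₂ * d * derivative (derivative d)
      + β₃ * derivative d ^ 2) (lo + 6) (hi + 10) w := by
  have hd' := hd.derivative
  have hd'' := hd'.derivative
  refine ((((h₀.mul hd.sq).congr (by ring) (by omega) rfl).add
    (((h₁.mul hd).mul hd').congr (by ring) (by omega) rfl)).add
    (((h₂.mul hd).mul hd'').congr (by ring) (by omega) rfl)).add
    ((h₃.mul hd'.sq).congr (by ring) (by omega) rfl) |>.congr rfl le_rfl ?_
  rw [← hw]
  push_cast
  ring

theorem hasShape_Bnumer {k : ℕ} (hk : k < 5) :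
    HasShape (Bnumer τ Nr k) (k + 5) (19 - k)
      (128 * (1 - τ) ^ 5 * (1 + 6 * τ + 2 * Nr * (1 - τ ^ 2))
        * (4 + 17 * τ + 6 * τ ^ 2 + 2 * Nr * (1 - τ ^ 2)) ^ 2 * Blow k) := by
  have ha := hasShape_pa τ Nr
  have hb := hasShape_pb τ Nr
  have hc := hasShape_pc τ Nr
  have hd := hasShape_pd τ Nr
  have hq := hasShape_pq τ
  have ha' := ha.derivative
  have ha'' := ha'.derivative
  have hb' := hb.derivative
  have hb'' := hb'.derivative
  have hc' := hc.derivative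
  have hc'' := hc'.derivative
  have hX := HasShape.X
  have hC := HasShape.const
  have hX2 := HasShape.X_pow 2
  have hX3 := HasShape.X_pow 3
  interval_cases k
  · refine (hasShape_numer (lo := -1) (hi := 9)
      (((((((hC _).mul ha'').mul hX).congr (by norm_num) (by norm_num) rfl).add
        ((hq.mul ha').congr (by norm_num) (by norm_num) rfl)).add
        ((((hC _).mul hX3).mul ha).weaken (by norm_num) (by norm_num) (by decide))).sub
        ((((hC _).mul hX2).mul hd).weaken (by norm_num) (by norm_num) (by decide)))
      (((((hC _).mul ha').mul hX).neg.congr (by norm_num) (by norm_num) rfl).sub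
        ((hq.mul ha).congr (by norm_num) (by norm_num) rfl))
      ((((hC _).mul ha).mul hX).neg.congr (by norm_num) (by norm_num) rfl)
      ((((hC _).mul ha).mul hX).congr (by norm_num) (by norm_num) rfl) hd rfl).congr
      (by norm_num) (by norm_num) ?_
    simp only [Blow]; push_cast; ring
  · refine (hasShape_numer (lo := 0) (hi := 8)
      ((((((hC _).mul ((((hC _).mul ha').congr (lo' := -1) (hi' := 5) (by norm_num) (by norm_num) rfl).add
          (hb''.congr (by norm_num) (by norm_num) rfl))).mul hX).congr
            (by norm_num) (by norm_num) rfl).add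
        ((hq.mul (ha.add (hb'.congr (by norm_num) (by norm_num) rfl))).congr
          (by norm_num) (by norm_num) rfl)).add
        ((((hC _).mul hX3).mul hb).weaken (by norm_num) (by norm_num) (by decide)))
      (((((hC _).mul (ha.add (hb'.congr (by norm_num) (by norm_num) rfl))).mul hX).neg.congr
          (by norm_num) (by norm_num) rfl).sub
        ((hq.mul hb).congr (by norm_num) (by norm_num) rfl))
      ((((hC _).mul hb).mul hX).neg.congr (by norm_num) (by norm_num) rfl)
      ((((hC _).mul hb).mul hX).congr (by norm_num) (by norm_num) rfl) hd rfl).congr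
      (by norm_num) (by norm_num) ?_
    simp only [Blow]; push_cast; ring
  · refine (hasShape_numer (lo := 1) (hi := 7)
      ((((((hC _).mul ((ha.add (((hC _).mul hb').congr (by norm_num) (by norm_num) rfl)).add
          (hc''.congr (by norm_num) (by norm_num) rfl))).mul hX).congr
            (by norm_num) (by norm_num) rfl).add
        ((hq.mul (hb.add (hc'.congr (by norm_num) (by norm_num) rfl))).congr
          (by norm_num) (by norm_num) rfl)).add
        ((((hC _).mul hX3).mul hc).weaken (by norm_num) (by norm_num) (by decide)))
      (((((hC _).mul (hb.add (hc'.congr (by norm_num) (by norm_num) rfl))).mul hX).neg.congr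
          (by norm_num) (by norm_num) rfl).sub
        ((hq.mul hc).congr (by norm_num) (by norm_num) rfl))
      ((((hC _).mul hc).mul hX).neg.congr (by norm_num) (by norm_num) rfl)
      ((((hC _).mul hc).mul hX).congr (by norm_num) (by norm_num) rfl) hd rfl).congr
      (by norm_num) (by norm_num) ?_
    simp only [Blow]; push_cast; ring
  · refine (hasShape_numer (lo := 2) (hi := 6)
      (((((hC _).mul (hb.add (((hC _).mul hc').congr (by norm_num) (by norm_num) rfl))).mul
          hX).congr (by norm_num) (by norm_num) rfl).add
        ((hq.mul hc).congr (by norm_num) (by norm_num) rfl))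
      ((((hC _).mul hc).mul hX).neg.congr (by norm_num) (by norm_num) rfl)
      HasShape.zero HasShape.zero hd rfl).congr (by norm_num) (by norm_num) ?_
    simp only [Blow]; push_cast; ring
  · refine (hasShape_numer (lo := 3) (hi := 5)
      ((((hC _).mul hc).mul hX).congr (by norm_num) (by norm_num) rfl)
      HasShape.zero HasShape.zero HasShape.zero hd rfl).congr (by norm_num) (by norm_num) ?_
    simp only [Blow]; ring

theorem X_pow_five_mul_Bpoly {k : ℕ} (hk : k < 5) :
    X ^ 5 * Bpoly τ Nr k = Bnumer τ Nr k :=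
  (hasShape_Bnumer τ Nr hk).X_pow_mul_divByMonic (by push_cast; omega)

theorem hasShape_Bpoly {k : ℕ} (hk : k < 5) :
    HasShape (Bpoly τ Nr k) k (14 - k)
      (128 * (1 - τ) ^ 5 * (1 + 6 * τ + 2 * Nr * (1 - τ ^ 2))
        * (4 + 17 * τ + 6 * τ ^ 2 + 2 * Nr * (1 - τ ^ 2)) ^ 2 * Blow k) :=
  ((hasShape_Bnumer τ Nr hk).divByMonic_X_pow (n := 5) (by push_cast; omega)).congr
    (by push_cast; ring) (by push_cast; omega) rfl

theorem HasShape.quadratic (c x y : ℝ) :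
    HasShape (-(C c * (C x * Polynomial.X ^ 2 + C y))) 0 2 (-(c * y)) :=
  (((HasShape.const c).mul (((HasShape.monomial x 2).weaken (by norm_num) le_rfl (by decide)).add
    ((HasShape.const y).congr rfl (by norm_num) rfl))).neg).congr rfl (by norm_num) (by ring)

theorem HasShape.cubic (c x y : ℝ) :
    HasShape (-(C c * (C x * Polynomial.X ^ 2 + C y) * Polynomial.X)) 1 3 (-(c * y)) := by
  have h := (HasShape.quadratic c x y).mul HasShape.X
  rw [neg_mul] at h
  exact h.congr rfl le_rfl (by ring)

theorem hasShape_alph {k j : ℕ} (hk : k < 8) (hj : j < 5) :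
    HasShape (alph τ Nr k j) (k - j - 3) (3 - k + j) (if k = j + 3 then (1 - τ) / 2 else 0) := by
  by_cases h : k = j + 3
  · rw [if_pos h]
    subst h
    interval_cases j <;> simp only [alph] <;>
      exact (HasShape.const _).congr (by norm_num) (by norm_num) rfl
  · rw [if_neg h]
    interval_cases k <;> interval_cases j <;>
      simp only [alph, not_true_eq_false, Nat.reduceAdd] at h ⊢ <;>
      first
      | with_reducible exact HasShape.zero
      | (with_reducible refine (HasShape.const _).weaken ?_ ?_ ?_) <;> decide
      | (with_reducible refine ((HasShape.const _).mul HasShape.X).weaken ?_ ?_ ?_) <;> decide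
      | (with_reducible refine (HasShape.quadratic _ _ _).weaken ?_ ?_ ?_) <;> decide
      | (with_reducible refine (HasShape.cubic _ _ _).weaken ?_ ?_ ?_) <;> decide

theorem hasShape_Apoly {k : ℕ} (hk : k < 8) :
    HasShape (Apoly τ Nr k) (k - 3) (17 - k)
      (if 3 ≤ k then 64 * (1 - τ) ^ 6 * (1 + 6 * τ + 2 * Nr * (1 - τ ^ 2))
        * (4 + 17 * τ + 6 * τ ^ 2 + 2 * Nr * (1 - τ ^ 2)) ^ 2 * Blow (k - 3) else 0) := by
  have h : ∀ {j : ℕ}, j < 5 → _ := fun {j} hj =>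
    ((hasShape_alph τ Nr hk hj).mul (hasShape_Bpoly τ Nr hj)).congr
      (show (k : ℤ) - j - 3 + j = k - 3 by ring) (show 3 - (k : ℤ) + j + (14 - j) ≤ 17 - k by omega)
      rfl
  have h5 := ((((HasShape.zero.add (h (show 0 < 5 by norm_num))).add
    (h (show 1 < 5 by norm_num))).add (h (show 2 < 5 by norm_num))).add
    (h (show 3 < 5 by norm_num))).add (h (show 4 < 5 by norm_num))
  unfold Apoly
  simp only [Finset.sum_range_succ, Finset.sum_range_zero]
  refine h5.congr rfl le_rfl ?_
  interval_cases k <;> norm_num <;> ring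

theorem frakCoeff_eq_intCoeff (k : ℕ) (j : ℤ) : frakCoeff τ Nr k j = intCoeff (Apoly τ Nr k) j :=
  rfl

end CoefficientShapes

section Composition
open Polynomial

variable (τ Nr : ℝ)

theorem alph_succ_succ {k j : ℕ} (hk : k < 7) (hj : j < 4) :
    alph τ Nr (k + 1) (j + 1) = alph τ Nr k j + derivative (alph τ Nr (k + 1) j) := by
  refine Polynomial.funext fun x => ?_
  interval_cases k <;> interval_cases j <;>
    simp only [alph, derivative_mul, derivative_add, derivative_neg, derivative_C, derivative_X_pow,
      derivative_X, derivative_zero, eval_add, eval_mul, eval_neg, eval_C, eval_X, eval_pow,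
      eval_zero, eval_one, Nat.reduceAdd] <;> norm_num <;> ring

theorem alph_zero_succ {j : ℕ} (hj : j < 4) :
    alph τ Nr 0 (j + 1) = derivative (alph τ Nr 0 j) := by
  refine Polynomial.funext fun x => ?_
  interval_cases j <;>
    simp only [alph, derivative_mul, derivative_add, derivative_neg, derivative_C, derivative_X_pow,
      derivative_X, eval_add, eval_mul, eval_neg, eval_C, eval_X, eval_pow,
      eval_zero, eval_one, Nat.reduceAdd] <;> norm_num <;> ring

theorem alph_seven {j : ℕ} (hj : j < 4) : alph τ Nr 7 j = 0 := by
  interval_cases j <;> rfl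

open PowerSeries in
theorem iterate_derivative_eq_sum_alph {M W : ℝ⟦X⟧}
    (hW : W = ∑ k ∈ range 8, (alph τ Nr k 0 : ℝ⟦X⟧) * (d⁄dX ℝ)^[k] M) {j : ℕ} (hj : j < 5) :
    (d⁄dX ℝ)^[j] W = ∑ k ∈ range 8, (alph τ Nr k j : ℝ⟦X⟧) * (d⁄dX ℝ)^[k] M := by
  induction j with
  | zero => exact hW
  | succ j ih =>
    have hj4 : j < 4 := by omega
    rw [Function.iterate_succ_apply', ih (by omega), map_sum]
    simp only [Derivation.leibniz, smul_eq_mul, PowerSeries.derivative_coe,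
      ← Function.iterate_succ_apply' (d⁄dX ℝ)]
    rw [sum_add_distrib, sum_range_succ, alph_seven τ Nr hj4, Polynomial.coe_zero, zero_mul,
      add_zero, sum_range_succ' _ 7, sum_range_succ' _ 7, ← add_assoc, ← sum_add_distrib,
      alph_zero_succ τ Nr hj4, mul_comm ((d⁄dX ℝ)^[0] M)]
    congr 1
    refine sum_congr rfl fun k hk => ?_
    rw [alph_succ_succ τ Nr (mem_range.1 hk) hj4, Polynomial.coe_add]
    ring

open PowerSeries in
theorem sum_Apoly_eq_sum_Bpoly {M W : ℝ⟦X⟧}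
    (hW : W = ∑ k ∈ range 8, (alph τ Nr k 0 : ℝ⟦X⟧) * (d⁄dX ℝ)^[k] M) :
    ∑ k ∈ range 8, (Apoly τ Nr k : ℝ⟦X⟧) * (d⁄dX ℝ)^[k] M =
      ∑ j ∈ range 5, (Bpoly τ Nr j : ℝ⟦X⟧) * (d⁄dX ℝ)^[j] W := by
  have h : ∀ j ∈ range 5, (Bpoly τ Nr j : ℝ⟦X⟧) * (d⁄dX ℝ)^[j] W =
      ∑ k ∈ range 8, (alph τ Nr k j : ℝ⟦X⟧) * (Bpoly τ Nr j : ℝ⟦X⟧) * (d⁄dX ℝ)^[k] M := by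
    intro j hj
    rw [iterate_derivative_eq_sum_alph τ Nr hW (mem_range.1 hj), mul_sum]
    exact sum_congr rfl fun k _ => by ring
  rw [sum_congr rfl h, sum_comm]
  refine sum_congr rfl fun k _ => ?_
  rw [← sum_mul, Apoly]
  congr 1
  simp only [← Polynomial.coe_mul]
  simp only [← Polynomial.coeToPowerSeries.ringHom_apply, map_sum]

open PowerSeries in
theorem coe_pa : (pa τ Nr : ℝ⟦X⟧) =
    -2*PowerSeries.C τ^2*(1+PowerSeries.C τ)^3*(1+2*PowerSeries.C τ) * PowerSeries.X^6
      + 4*PowerSeries.C τ*(1+PowerSeries.C τ)^2*(1+8*PowerSeries.C τ-5*PowerSeries.C τ*(1-PowerSeries.C τ^2)*PowerSeries.C Nr) * PowerSeries.X^4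
      + 8*(1-PowerSeries.C τ^2)*(1-3*PowerSeries.C τ-30*PowerSeries.C τ^2+(1-PowerSeries.C τ^2)*(3+4*PowerSeries.C τ+4*PowerSeries.C τ^2)*PowerSeries.C Nr+2*(1-PowerSeries.C τ^2)^2*PowerSeries.C Nr^2) * PowerSeries.X^2
      + 32*(1-PowerSeries.C τ)^2*(1+6*PowerSeries.C τ+2*(1-PowerSeries.C τ^2)*PowerSeries.C Nr) := by
  simp only [pa, Polynomial.coe_mul, Polynomial.coe_add, Polynomial.coe_C,
    Polynomial.coe_X, Polynomial.coe_pow]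
  simp only [map_mul, map_sub, map_add, map_pow, map_neg, map_one, map_ofNat]

open PowerSeries in
theorem coe_pb : (pb τ Nr : ℝ⟦X⟧) =
    -2*PowerSeries.C τ*(1+PowerSeries.C τ)^2*(1-PowerSeries.C τ-6*PowerSeries.C τ^2) * PowerSeries.X^5
      + 4*(1-PowerSeries.C τ^2)*((1-2*PowerSeries.C τ)*(1+7*PowerSeries.C τ)+2*(1-PowerSeries.C τ)^3*(1+PowerSeries.C τ)*PowerSeries.C Nr) * PowerSeries.X^3
      - 32*(1-PowerSeries.C τ)^2*(1+6*PowerSeries.C τ+2*(1-PowerSeries.C τ^2)*PowerSeries.C Nr) * PowerSeries.X := by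
  simp only [pb, Polynomial.coe_mul, Polynomial.coe_add, Polynomial.coe_sub, Polynomial.coe_C,
    Polynomial.coe_X, Polynomial.coe_pow]
  simp only [map_mul, map_sub, map_add, map_pow, map_neg, map_one, map_ofNat]

open PowerSeries in
theorem coe_pc : (pc τ Nr : ℝ⟦X⟧) =
    4*PowerSeries.C τ*(1-PowerSeries.C τ^2)*(1+2*PowerSeries.C τ) * PowerSeries.X^4 - 8*(1-PowerSeries.C τ)^2*(1+6*PowerSeries.C τ+2*PowerSeries.C Nr*(1-PowerSeries.C τ^2)) * PowerSeries.X^2 := by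
  simp only [pc, Polynomial.coe_mul, Polynomial.coe_sub, Polynomial.coe_C,
    Polynomial.coe_X, Polynomial.coe_pow]
  simp only [map_mul, map_sub, map_add, map_pow, map_one, map_ofNat]

open PowerSeries in
theorem coe_pd : (pd τ Nr : ℝ⟦X⟧) =
    PowerSeries.C τ*(1+PowerSeries.C τ)*(2+PowerSeries.C τ)*(1+2*PowerSeries.C τ) * PowerSeries.X^5 - 2*(1-PowerSeries.C τ)*(4+17*PowerSeries.C τ+6*PowerSeries.C τ^2+2*PowerSeries.C Nr*(1-PowerSeries.C τ^2)) * PowerSeries.X^3 := by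
  simp only [pd, Polynomial.coe_mul, Polynomial.coe_sub, Polynomial.coe_C,
    Polynomial.coe_X, Polynomial.coe_pow]
  simp only [map_mul, map_sub, map_add, map_pow, map_one, map_ofNat]

open PowerSeries in
theorem coe_pq : (pq τ : ℝ⟦X⟧) =
    2*PowerSeries.C τ*(1+PowerSeries.C τ)*(4-PowerSeries.C τ) * PowerSeries.X^2 - 4*(1-PowerSeries.C τ) := by
  simp only [pq, Polynomial.coe_mul, Polynomial.coe_sub, Polynomial.coe_C,
    Polynomial.coe_X, Polynomial.coe_pow]
  simp only [map_mul, map_sub, map_add, map_one, map_ofNat]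

open PowerSeries in
theorem sum_Apoly_mul_iterate_derivative {u Y Z V V₂ : ℝ⟦X⟧}
    (hY : 2 * d⁄dX ℝ Y = (1 + PowerSeries.C τ) * PowerSeries.X * (Y + (PowerSeries.C Nr - 1) * u))
    (hu : (1 - PowerSeries.C τ) * (u + PowerSeries.X * d⁄dX ℝ u) =
      (1 + PowerSeries.C τ) * (2 * Y - PowerSeries.C τ * PowerSeries.X ^ 2 * u
        - 2 * PowerSeries.C τ * (PowerSeries.C Nr - 1) * Z))
    (hZ : 2 * d⁄dX ℝ Z = (1 + PowerSeries.C τ) * PowerSeries.X * (u - PowerSeries.C τ * Z))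
    (hV : 2 * d⁄dX ℝ V = (1 + PowerSeries.C τ) *
      (2 * PowerSeries.X * V + 2 * (PowerSeries.C Nr - 1) * V₂ + PowerSeries.X * u))
    (hV₂ : d⁄dX ℝ V₂ = (1 + PowerSeries.C τ) *
      (V - PowerSeries.C τ * Z - PowerSeries.C τ * PowerSeries.X * V₂)) :
    ∑ k ∈ range 8, (Apoly τ Nr k : ℝ⟦X⟧) * (d⁄dX ℝ)^[k] (u + V) = 0 := by
  have hτ : d⁄dX ℝ (PowerSeries.C τ) = 0 := PowerSeries.derivative_C
  have hN : d⁄dX ℝ (PowerSeries.C Nr) = 0 := PowerSeries.derivative_C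
  have ht : d⁄dX ℝ (PowerSeries.X : ℝ⟦X⟧) = 1 := PowerSeries.derivative_X
  have ht0 : (PowerSeries.X : ℝ⟦X⟧) ≠ 0 := PowerSeries.X_ne_zero
  have : CharZero ℝ⟦X⟧ := charZero_of_injective_ringHom (PowerSeries.C_injective (R := ℝ))
  obtain ⟨M, hM⟩ : ∃ M, M = u + V := ⟨_, rfl⟩
  obtain ⟨W, hW⟩ : ∃ W : ℝ⟦X⟧, W =
    ∑ k ∈ range 8, (alph τ Nr k 0 : ℝ⟦X⟧) * (d⁄dX ℝ)^[k] M := ⟨_, rfl⟩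
  rw [← hM, sum_Apoly_eq_sum_Bpoly τ Nr hW]
  have h2 : (2 : ℝ⟦X⟧) * PowerSeries.C (2⁻¹ : ℝ) = 1 := by
    rw [← map_ofNat (PowerSeries.C (R := ℝ)) 2, ← map_mul]; norm_num
  have hI := density_third_order (d⁄dX ℝ) hτ hN ht hY hu hZ hV hV₂ hM (W := W) (by
    rw [hW]
    simp only [alph, sum_range_succ, sum_range_zero, Function.iterate_succ_apply',
      Function.iterate_zero_apply, Polynomial.coe_mul, Polynomial.coe_add, Polynomial.coe_neg,
      Polynomial.coe_C, Polynomial.coe_X, Polynomial.coe_pow, Polynomial.coe_zero, div_eq_mul_inv]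
    simp only [map_mul, map_sub, map_add, map_pow, map_neg, map_one, map_ofNat]
    linear_combination ((1 - PowerSeries.C τ) * d⁄dX ℝ (d⁄dX ℝ (d⁄dX ℝ M))
      - (1 + PowerSeries.C τ) * (PowerSeries.C τ ^ 2 - 3 * PowerSeries.C τ + 1) * PowerSeries.X * d⁄dX ℝ (d⁄dX ℝ M)
      - (1 - PowerSeries.C τ ^ 2) * (2 * PowerSeries.C τ * (1 + PowerSeries.C τ) * PowerSeries.X ^ 2
        + (1 + PowerSeries.C τ) * PowerSeries.C Nr + 1 - 2 * PowerSeries.C τ) * d⁄dX ℝ M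
      - PowerSeries.C τ * (1 + PowerSeries.C τ) ^ 2
        * (PowerSeries.C τ * (1 + PowerSeries.C τ) * PowerSeries.X ^ 2
          + (1 + PowerSeries.C τ) * PowerSeries.C Nr + 2 - 3 * PowerSeries.C τ)
        * PowerSeries.X * M) * h2)
  have hJ := second_order_of_density (d⁄dX ℝ) hτ hN ht ht0
    (third_order_ode (d⁄dX ℝ) hτ hN ht hY hu hZ) hI (coe_pa τ Nr) (coe_pb τ Nr) (coe_pc τ Nr) (coe_pd τ Nr)
  have hK := fourth_order_of_second_order (d⁄dX ℝ) (by simp [hτ, hN, Derivation.leibniz_pow]) hJ hI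
  have h5 : (PowerSeries.X : ℝ⟦X⟧) ^ 5 *
      ∑ j ∈ range 5, (Bpoly τ Nr j : ℝ⟦X⟧) * (d⁄dX ℝ)^[j] W =
      ∑ j ∈ range 5, (Bnumer τ Nr j : ℝ⟦X⟧) * (d⁄dX ℝ)^[j] W := by
    rw [mul_sum]
    refine sum_congr rfl fun j hj => ?_
    rw [← X_pow_five_mul_Bpoly τ Nr (mem_range.1 hj), Polynomial.coe_mul, Polynomial.coe_pow,
      Polynomial.coe_X, mul_assoc]
  refine (mul_eq_zero.1 (h5.trans ?_)).resolve_left (pow_ne_zero 5 ht0)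
  simp only [sum_range_succ, sum_range_zero, Bnumer, tβ, Function.iterate_succ_apply',
    Function.iterate_zero_apply, Polynomial.coe_mul, Polynomial.coe_add, Polynomial.coe_sub,
    Polynomial.coe_neg,
    Polynomial.coe_C, Polynomial.coe_X, Polynomial.coe_pow, Polynomial.coe_zero,
    ← PowerSeries.derivative_coe, coe_pq]
  simp only [map_mul, map_sub, map_add, map_pow, map_one, map_ofNat] at hK ⊢
  linear_combination hK

end Composition

section Extraction
open Polynomial

/-- The exponential generating series of a real sequence. -/
noncomputable def egf (m : ℕ → ℝ) : PowerSeries ℝ := PowerSeries.mk fun n => m n / n.factorial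

theorem coeff_iterate_derivative_egf (m : ℕ → ℝ) (n k : ℕ) :
    PowerSeries.coeff n ((PowerSeries.derivative ℝ)^[k] (egf m)) = m (n + k) / n.factorial := by
  have h : ((n.factorial : ℝ)) * ((n + 1).ascFactorial k : ℝ) = (n + k).factorial := by
    exact_mod_cast Nat.factorial_mul_ascFactorial n k
  have h1 : (n.factorial : ℝ) ≠ 0 := by exact_mod_cast n.factorial_ne_zero
  have h2 : ((n + k).factorial : ℝ) ≠ 0 := by exact_mod_cast (n + k).factorial_ne_zero
  rw [PowerSeries.coeff_iterate_derivative, egf, PowerSeries.coeff_mk]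
  field_simp
  rw [← h]
  ring

theorem poch_natCast (j i : ℕ) :
    poch ((j : ℝ) + 1) i = (j + i).factorial / j.factorial := by
  have h1 : (j.factorial : ℝ) ≠ 0 := by exact_mod_cast j.factorial_ne_zero
  rw [poch, if_pos (Int.natCast_nonneg i), Int.toNat_natCast, eq_div_iff h1, ← Nat.cast_succ,
    ← ascPochhammer_eval_cast, ascPochhammer_nat_eq_ascFactorial]
  exact_mod_cast (mul_comm _ _).trans (Nat.factorial_mul_ascFactorial j i)

theorem HasShape.factorial_mul_coeff {A : ℝ[X]} {k p : ℕ} {v : ℝ} (m : ℕ → ℝ) (hp : 10 ≤ p)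
    (hk : k < 8) (hA : HasShape A (k - 3) (17 - k) v) :
    ((2 * p - 3).factorial : ℝ) * PowerSeries.coeff (2 * p - 3)
        ((A : PowerSeries ℝ) * (PowerSeries.derivative ℝ)^[k] (egf m)) =
      ∑ l ∈ range 11, poch (2 * (p : ℝ) - k - 2 * l + 1) ((k : ℤ) + 2 * l - 3)
        * intCoeff A ((k : ℤ) + 2 * l - 3) * m (2 * p - 2 * l) := by
  have hterm : ∀ i j : ℕ, i + j = 2 * p - 3 →
      ((2 * p - 3).factorial : ℝ) * (A.coeff i * (m (j + k) / j.factorial)) =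
        poch ((j : ℝ) + 1) i * A.coeff i * m (j + k) := by
    intro i j hij
    rw [poch_natCast, add_comm j i, hij]
    ring
  rw [PowerSeries.coeff_mul, Finset.Nat.sum_antidiagonal_eq_sum_range_succ_mk, mul_sum]
  simp only [Polynomial.coeff_coe, coeff_iterate_derivative_egf]
  have hnonneg : ∀ l : ℕ, poch (2 * (p : ℝ) - k - 2 * l + 1) ((k : ℤ) + 2 * l - 3)
        * intCoeff A ((k : ℤ) + 2 * l - 3) * m (2 * p - 2 * l) ≠ 0 →
        0 ≤ (k : ℤ) + 2 * l - 3 ∧ (k : ℤ) + 2 * l - 3 ≤ 17 - k := by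
    intro l hl
    have h := right_ne_zero_of_mul (left_ne_zero_of_mul hl)
    constructor
    · by_contra hneg
      exact h (intCoeff_of_neg A (not_le.1 hneg))
    · by_contra hneg
      exact h (hA.intCoeff_eq_zero (Or.inr (not_le.1 hneg)))
  symm
  refine sum_bij_ne_zero (fun l _ _ => ((k : ℤ) + 2 * l - 3).toNat) ?_ ?_ ?_ ?_
  · intro l _ hl
    have := hnonneg l hl
    rw [mem_range]
    omega
  · intro l _ hl l' _ hl' h
    have := hnonneg l hl
    have := hnonneg l' hl'
    omega
  · intro i hi hne
    rw [mem_range] at hi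
    obtain ⟨h1, h2, r, h3⟩ := hA.supp i (left_ne_zero_of_mul (right_ne_zero_of_mul hne))
    have hr : (k : ℤ) + 2 * (r.toNat : ℤ) - 3 = i := by omega
    refine ⟨r.toNat, by rw [mem_range]; omega, ?_, by omega⟩
    rw [hterm i _ (by omega)] at hne
    rw [hr, intCoeff_natCast]
    have e1 : 2 * (p : ℝ) - k - 2 * (r.toNat : ℝ) + 1 = ((2 * p - 3 - i : ℕ) : ℝ) + 1 := by
      have : 2 * p = (2 * p - 3 - i) + k + 2 * r.toNat := by omega
      have : 2 * (p : ℝ) = ((2 * p - 3 - i : ℕ) : ℝ) + k + 2 * (r.toNat : ℝ) := by exact_mod_cast this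
      linarith
    have e2 : 2 * p - 2 * r.toNat = 2 * p - 3 - i + k := by omega
    rwa [e1, e2]
  · intro l _ hl
    obtain ⟨h1, h2⟩ := hnonneg l hl
    obtain ⟨i, hi⟩ := Int.eq_ofNat_of_zero_le h1
    rw [hi, Int.toNat_natCast, hterm i _ (by omega), intCoeff_natCast]
    have e1 : 2 * (p : ℝ) - k - 2 * (l : ℝ) + 1 = ((2 * p - 3 - i : ℕ) : ℝ) + 1 := by
      have : 2 * p = (2 * p - 3 - i) + k + 2 * l := by omega
      have : 2 * (p : ℝ) = ((2 * p - 3 - i : ℕ) : ℝ) + k + 2 * (l : ℝ) := by exact_mod_cast this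
      linarith
    have e2 : 2 * p - 2 * l = 2 * p - 3 - i + k := by omega
    rw [e1, e2]

/-- The sum over all `k` of the contributions of `A_k` to the coefficient of `m (2 * p - 2 * l)`. -/
noncomputable def recCoeff (τ Nr : ℝ) (p l : ℕ) : ℝ :=
  ∑ k ∈ range 8, poch (2 * (p : ℝ) - k - 2 * l + 1) ((k : ℤ) + 2 * l - 3)
    * frakCoeff τ Nr k ((k : ℤ) + 2 * l - 3)

theorem sum_recCoeff_eq_zero {τ Nr : ℝ} {m : ℕ → ℝ} {p : ℕ} (hp : 10 ≤ p)
    (h : ∑ k ∈ range 8, (Apoly τ Nr k : PowerSeries ℝ)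
      * (PowerSeries.derivative ℝ)^[k] (egf m) = 0) :
    ∑ l ∈ range 11, recCoeff τ Nr p l * m (2 * p - 2 * l) = 0 := by
  have h' := congrArg (fun F => ((2 * p - 3).factorial : ℝ) * PowerSeries.coeff (2 * p - 3) F) h
  simp only [map_sum, mul_sum, map_zero, mul_zero] at h'
  simp only [recCoeff, sum_mul]
  rw [sum_comm, ← h']
  refine sum_congr rfl fun k hk => ?_
  rw [(hasShape_Apoly τ Nr (mem_range.1 hk)).factorial_mul_coeff m hp (mem_range.1 hk)]
  rfl

theorem recCoeff_eq_sum_range_min (τ Nr : ℝ) (p : ℕ) {l : ℕ} (hl : l ≤ 10) :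
    recCoeff τ Nr p l = ∑ k ∈ range (min (10 - l) 7 + 1),
      poch (2 * (p : ℝ) - k - 2 * l + 1) ((k : ℤ) + 2 * l - 3)
        * frakCoeff τ Nr k ((k : ℤ) + 2 * l - 3) := by
  refine (sum_subset (range_subset_range.2 (by omega)) fun k hk hk' => ?_).symm
  rw [mem_range] at hk hk'
  rw [frakCoeff_eq_intCoeff,
    (hasShape_Apoly τ Nr hk).intCoeff_eq_zero (Or.inr (by omega)), mul_zero]

theorem recCoeff_zero (τ Nr : ℝ) (p : ℕ) :
    recCoeff τ Nr p 0 =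
      -((1 + 6 * τ + 2 * Nr * (1 - τ ^ 2)) * (4 + 17 * τ + 6 * τ ^ 2 + 2 * Nr * (1 - τ ^ 2)) ^ 2
        * (256 * ((p : ℝ) - 4) * ((p : ℝ) - 3) * ((p : ℝ) - 2))
        * (2 * (2 * (p : ℝ) + 1) * (1 - τ) ^ 6)) := by
  have hlow : ∀ k ∈ range 8, poch (2 * (p : ℝ) - k - 2 * (0 : ℕ) + 1)
      ((k : ℤ) + 2 * (0 : ℕ) - 3) * frakCoeff τ Nr k ((k : ℤ) + 2 * (0 : ℕ) - 3) =
      poch (2 * (p : ℝ) - k + 1) ((k : ℤ) - 3) *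
        (if 3 ≤ k then 64 * (1 - τ) ^ 6 * (1 + 6 * τ + 2 * Nr * (1 - τ ^ 2))
          * (4 + 17 * τ + 6 * τ ^ 2 + 2 * Nr * (1 - τ ^ 2)) ^ 2 * Blow (k - 3) else 0) := by
    intro k hk
    rw [← (hasShape_Apoly τ Nr (mem_range.1 hk)).low, frakCoeff_eq_intCoeff]
    simp
  rw [recCoeff, sum_congr rfl hlow]
  simp [sum_range_succ, poch, Blow, ascPochhammer_succ_eval]
  ring

theorem recurrence_of_sum_Apoly {τ : ℝ} (hτ : τ ∈ Set.Icc (0 : ℝ) 1) {Nr : ℝ} (hN : 0 ≤ Nr)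
    {m : ℕ → ℝ} {p : ℕ} (hp : 10 ≤ p)
    (h : ∑ k ∈ range 8, (Apoly τ Nr k : PowerSeries ℝ)
      * (PowerSeries.derivative ℝ)^[k] (egf m) = 0) :
    2 * (2 * (p : ℝ) + 1) * (1 - τ) ^ 6 * m (2 * p)
      = ∑ l ∈ Finset.Icc 1 10, frakA τ Nr p l * m (2 * p - 2 * l) := by
  have hsum := sum_recCoeff_eq_zero hp h
  obtain ⟨h0, h1⟩ := hτ
  have hp' : (10 : ℝ) ≤ p := by exact_mod_cast hp
  have hq : 0 ≤ 2 * Nr * (1 - τ ^ 2) :=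
    mul_nonneg (by linarith) (sub_nonneg.2 (pow_le_one₀ h0 h1))
  have hE : 0 < 1 + 6 * τ + 2 * Nr * (1 - τ ^ 2) := by linarith
  have hF : 0 < 4 + 17 * τ + 6 * τ ^ 2 + 2 * Nr * (1 - τ ^ 2) := by linarith [sq_nonneg τ]
  have hG : 0 < 256 * ((p : ℝ) - 4) * ((p : ℝ) - 3) * ((p : ℝ) - 2) := by
    have h2 : 0 < (p : ℝ) - 2 := by linarith
    have h3 : 0 < (p : ℝ) - 3 := by linarith
    have h4 : 0 < (p : ℝ) - 4 := by linarith
    positivity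
  have hK := mul_pos (mul_pos hE (pow_pos hF 2)) hG
  have hA : ∀ l ∈ Finset.Icc 1 10, frakA τ Nr p l * m (2 * p - 2 * l) =
      ((1 + 6 * τ + 2 * Nr * (1 - τ ^ 2)) * (4 + 17 * τ + 6 * τ ^ 2 + 2 * Nr * (1 - τ ^ 2)) ^ 2
        * (256 * ((p : ℝ) - 4) * ((p : ℝ) - 3) * ((p : ℝ) - 2)))⁻¹ *
      (recCoeff τ Nr p l * m (2 * p - 2 * l)) := by
    intro l hl
    rw [recCoeff_eq_sum_range_min τ Nr p (Finset.mem_Icc.1 hl).2, frakA, one_div, one_div,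
      ← mul_inv, mul_assoc]
  rw [sum_congr rfl hA, ← mul_sum, eq_inv_mul_iff_mul_eq₀ hK.ne']
  rw [Finset.range_eq_Ico, sum_eq_sum_Ico_succ_bot (by norm_num), recCoeff_zero] at hsum
  have hIcc : Finset.Icc 1 10 = Finset.Ico (0 + 1) 11 := rfl
  rw [hIcc]
  generalize ∑ l ∈ Finset.Ico (0 + 1) 11, recCoeff τ Nr p l * m (2 * p - 2 * l) = S at hsum ⊢
  rw [mul_zero, Nat.sub_zero] at hsum
  linear_combination -hsum

end Extraction

section MomentSeries

/-- All moments of `φ` against Lebesgue measure exist. -/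
def HasMoments (φ : ℝ → ℝ) : Prop := ∀ n : ℕ, Integrable fun x => x ^ n * φ x

/-- The exponential generating series of the moments of `φ`. -/
noncomputable def momentSeries (φ : ℝ → ℝ) : PowerSeries ℝ := egf fun n => ∫ x, x ^ n * φ x

namespace HasMoments

variable {φ ψ : ℝ → ℝ}

theorem add (hφ : HasMoments φ) (hψ : HasMoments ψ) : HasMoments fun x => φ x + ψ x :=
  fun n => ((hφ n).add (hψ n)).congr (.of_forall fun x => by simp only [Pi.add_apply]; ring)

theorem const_mul (c : ℝ) (hφ : HasMoments φ) : HasMoments fun x => c * φ x :=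
  fun n => ((hφ n).const_mul c).congr (.of_forall fun x => by ring)

theorem sub (hφ : HasMoments φ) (hψ : HasMoments ψ) : HasMoments fun x => φ x - ψ x :=
  fun n => ((hφ n).sub (hψ n)).congr (.of_forall fun x => by simp only [Pi.sub_apply]; ring)

theorem id_mul (hφ : HasMoments φ) : HasMoments fun x => x * φ x :=
  fun n => (hφ (n + 1)).congr (.of_forall fun x => by ring)

theorem mul_CH (hφ : HasMoments φ) (τ : ℝ) : ∀ k, HasMoments fun x => φ x * CH τ k x
  | 0 => by simpa [CH] using hφ
  | 1 => fun n => (hφ.id_mul n).congr (.of_forall fun x => by simp only [CH]; ring)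
  | k + 2 => fun n => (((hφ.mul_CH τ (k + 1)).id_mul.sub
      ((hφ.mul_CH τ k).const_mul (((k : ℝ) + 1) * τ))) n).congr
        (.of_forall fun x => by simp only [CH]; ring)

theorem mul_bdd (hφ : HasMoments φ) (hψ : Continuous ψ) {c : ℝ} (hc : ∀ x, |ψ x| ≤ c) :
    HasMoments fun x => φ x * ψ x :=
  fun n => ((hφ n).mul_bdd hψ.aestronglyMeasurable (.of_forall hc)).congr
    (.of_forall fun x => by ring)

theorem finset_sum {ι : Type*} (s : Finset ι) {φ : ι → ℝ → ℝ} (hφ : ∀ i ∈ s, HasMoments (φ i)) :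
    HasMoments fun x => ∑ i ∈ s, φ i x :=
  fun n => (integrable_finsetSum s fun i hi => hφ i hi n).congr
    (.of_forall fun x => by simp only [mul_sum])

theorem integrable (hφ : HasMoments φ) : Integrable φ := by simpa using hφ 0

end HasMoments

variable {φ ψ : ℝ → ℝ}

theorem egf_add (m m' : ℕ → ℝ) : egf (fun n => m n + m' n) = egf m + egf m' := by
  ext n
  simp [egf, add_div]

theorem momentSeries_add (hφ : HasMoments φ) (hψ : HasMoments ψ) :
    momentSeries (fun x => φ x + ψ x) = momentSeries φ + momentSeries ψ := by
  rw [momentSeries, momentSeries, momentSeries, ← egf_add]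
  congr 1
  funext n
  simp only [mul_add]
  exact integral_add (hφ n) (hψ n)

theorem momentSeries_const_mul (c : ℝ) (φ : ℝ → ℝ) :
    momentSeries (fun x => c * φ x) = PowerSeries.C c * momentSeries φ := by
  ext n
  simp only [momentSeries, egf, PowerSeries.coeff_mk, PowerSeries.coeff_C_mul, mul_left_comm _ c,
    integral_const_mul]
  ring

theorem momentSeries_id_mul (φ : ℝ → ℝ) :
    momentSeries (fun x => x * φ x) = PowerSeries.derivative ℝ (momentSeries φ) := by
  ext n
  have h := coeff_iterate_derivative_egf (fun n => ∫ x, x ^ n * φ x) n 1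
  rw [Function.iterate_one] at h
  rw [momentSeries, momentSeries, h, egf, PowerSeries.coeff_mk]
  simp only [pow_succ, mul_assoc]

theorem momentSeries_deriv (hφ : HasMoments φ) (hψ : HasMoments ψ)
    (h : ∀ x, HasDerivAt φ (ψ x) x) : momentSeries ψ = -(PowerSeries.X * momentSeries φ) := by
  ext n
  rcases n with _ | n
  · have h0 := integral_eq_zero_of_hasDerivAt_of_integrable h hψ.integrable hφ.integrable
    simp [momentSeries, egf, h0]
  · have hd : ∀ x, HasDerivAt (fun x => x ^ (n + 1) * φ x)
        (((n : ℝ) + 1) * (x ^ n * φ x) + x ^ (n + 1) * ψ x) x := fun x => by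
      refine ((hasDerivAt_pow (n + 1) x).mul (h x)).congr_deriv ?_
      push_cast [Nat.add_sub_cancel]
      ring
    have h0 := integral_eq_zero_of_hasDerivAt_of_integrable hd
      (((hφ n).const_mul _).add (hψ (n + 1))) (hφ (n + 1))
    rw [integral_add ((hφ n).const_mul _) (hψ (n + 1)), integral_const_mul] at h0
    have h1 : (n.factorial : ℝ) ≠ 0 := by exact_mod_cast n.factorial_ne_zero
    have h2 : (n : ℝ) + 1 ≠ 0 := by positivity
    rw [map_neg, PowerSeries.coeff_succ_X_mul]
    simp only [momentSeries, egf, PowerSeries.coeff_mk, Nat.factorial_succ, Nat.cast_mul,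
      Nat.cast_succ]
    field_simp
    linarith

end MomentSeries

section EllipticDensity

theorem CH_lowering (τ x : ℝ) :
    ∀ k : ℕ, τ * (k * CH τ (k - 1) x) = x * CH τ k x - CH τ (k + 1) x
  | 0 => by simp [CH]
  | k + 1 => by
    rw [CH, Nat.add_sub_cancel]
    push_cast
    ring

theorem hasDerivAt_CH (τ : ℝ) : ∀ (k : ℕ) (x : ℝ),
    HasDerivAt (CH τ k) (k * CH τ (k - 1) x) x
  | 0, x => by simpa [CH] using hasDerivAt_const x (1 : ℝ)
  | 1, x => by simpa [CH] using hasDerivAt_id' x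
  | k + 2, x => by
    have h : HasDerivAt (CH τ (k + 2)) _ x := ((hasDerivAt_id' x).fun_mul
      (hasDerivAt_CH τ (k + 1) x)).fun_sub
      ((hasDerivAt_CH τ k x).const_mul (((k : ℝ) + 1) * τ))
    refine h.congr_deriv ?_
    have hl := CH_lowering τ x k
    simp only [Nat.add_sub_cancel, Nat.reduceSubDiff]
    push_cast
    linear_combination (-(k : ℝ) - 1) * hl

theorem continuous_CH (τ : ℝ) (k : ℕ) : Continuous (CH τ k) :=
  continuous_iff_continuousAt.2 fun x => (hasDerivAt_CH τ k x).continuousAt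

/-- The Gaussian weight `exp (-x² / (2 (1 + τ)))`. -/
noncomputable def ellWeight (τ x : ℝ) : ℝ := exp (-x ^ 2 / (2 * (1 + τ)))

theorem continuous_ellWeight (τ : ℝ) : Continuous (ellWeight τ) := by
  unfold ellWeight
  fun_prop

theorem hasDerivAt_ellWeight {τ : ℝ} (hτ : 0 ≤ τ) (x : ℝ) :
    HasDerivAt (ellWeight τ) (-(x / (1 + τ)) * ellWeight τ x) x := by
  have h : HasDerivAt (fun x : ℝ => -x ^ 2 / (2 * (1 + τ))) (-(x / (1 + τ))) x := by
    refine ((hasDerivAt_pow 2 x).fun_neg.div_const (2 * (1 + τ))).congr_deriv ?_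
    have : 1 + τ ≠ 0 := by positivity
    field_simp
    simp
  exact h.exp.congr_deriv (mul_comm _ _)

theorem ellWeight_sq (τ x : ℝ) : ellWeight τ x ^ 2 = exp (-x ^ 2 / (1 + τ)) := by
  rw [ellWeight, ← exp_nat_mul]
  congr 1
  rw [mul_comm 2 (1 + τ), ← div_div]
  push_cast
  ring

theorem abs_ellWeight_le_one {τ : ℝ} (hτ : 0 ≤ τ) (x : ℝ) : |ellWeight τ x| ≤ 1 := by
  rw [ellWeight, abs_exp, exp_le_one_iff, neg_div]
  have : 0 ≤ x ^ 2 / (2 * (1 + τ)) := by positivity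
  linarith

theorem hasMoments_ellWeight {τ : ℝ} (hτ : 0 ≤ τ) : HasMoments (ellWeight τ) := fun n => by
  have h := integrable_rpow_mul_exp_neg_mul_sq (b := (2 * (1 + τ))⁻¹) (by positivity)
    (s := n) (by linarith [n.cast_nonneg (α := ℝ)])
  refine h.congr (.of_forall fun x => ?_)
  simp only [ellWeight, rpow_natCast]
  congr 2
  ring

/-- The incomplete integral of the weighted polynomial `C_n`. -/
noncomputable def ellPrimitive (τ : ℝ) (n : ℕ) (x : ℝ) : ℝ :=
  ∫ u in (0 : ℝ)..x, ellWeight τ u * CH τ n u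

theorem hasDerivAt_ellPrimitive (τ : ℝ) (n : ℕ) (x : ℝ) :
    HasDerivAt (ellPrimitive τ n) (ellWeight τ x * CH τ n x) x :=
  ((continuous_ellWeight τ).mul (continuous_CH τ n)).integral_hasStrictDerivAt 0 x |>.hasDerivAt

theorem abs_ellPrimitive_le {τ : ℝ} (hτ : 0 ≤ τ) (n : ℕ) (x : ℝ) :
    |ellPrimitive τ n x| ≤ ∫ u, |ellWeight τ u * CH τ n u| :=
  intervalIntegral.norm_integral_le_integral_norm_uIoc.trans <|
    setIntegral_le_integral ((hasMoments_ellWeight hτ).mul_CH τ n).integrable.norm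
      (.of_forall fun _ => abs_nonneg _)

theorem HasMoments.ellWeight_mul_ellPrimitive {τ : ℝ} (hτ : 0 ≤ τ) (n k : ℕ) :
    HasMoments fun x => ellWeight τ x * CH τ k x * ellPrimitive τ n x :=
  ((hasMoments_ellWeight hτ).mul_CH τ k).mul_bdd
    (continuous_iff_continuousAt.2 fun x => (hasDerivAt_ellPrimitive τ n x).continuousAt)
    (abs_ellPrimitive_le hτ n)

theorem HasMoments.ellWeight_sq_mul {τ : ℝ} (hτ : 0 ≤ τ) (j k : ℕ) :
    HasMoments fun x => ellWeight τ x ^ 2 * CH τ j x * CH τ k x := by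
  simpa only [pow_two] using (((hasMoments_ellWeight hτ).mul_bdd (continuous_ellWeight τ)
    (abs_ellWeight_le_one hτ)).mul_CH τ j).mul_CH τ k

/-- A Christoffel--Darboux type identity for the polynomials `C_k`. -/
theorem sum_CH_sq_sub (τ x : ℝ) (n : ℕ) :
    x * ∑ k ∈ range (n + 1), CH τ k x ^ 2 / k.factorial
      - (1 + τ) * ∑ k ∈ range (n + 1), CH τ k x * (k * CH τ (k - 1) x) / k.factorial
      = CH τ (n + 1) x * CH τ n x / n.factorial := by
  induction n with
  | zero => simp [CH]
  | succ n ih =>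
    rw [sum_range_succ, sum_range_succ _ (n + 1), mul_add, mul_add, add_sub_add_comm, ih,
      Nat.add_sub_cancel, Nat.factorial_succ, CH]
    have h1 : (n.factorial : ℝ) ≠ 0 := by exact_mod_cast n.factorial_ne_zero
    have h2 : (n : ℝ) + 1 ≠ 0 := by positivity
    push_cast
    field_simp
    ring

variable {τ : ℝ}

theorem R1_add_two (τ : ℝ) (n : ℕ) : R1 τ (n + 2) = fun x => ∑ k ∈ range (n + 1),
    (√(2 * π))⁻¹ * (k.factorial : ℝ)⁻¹ * (ellWeight τ x ^ 2 * CH τ k x * CH τ k x) := by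
  funext x
  rw [R1, ← ellWeight_sq, mul_sum]
  refine sum_congr rfl fun k _ => ?_
  ring

theorem hasMoments_R1 (hτ : 0 ≤ τ) (n : ℕ) : HasMoments (R1 τ (n + 2)) := by
  rw [R1_add_two]
  exact HasMoments.finset_sum _ fun k _ => (HasMoments.ellWeight_sq_mul hτ k k).const_mul _

theorem hasDerivAt_ellWeight_sq (hτ : 0 ≤ τ) (x : ℝ) :
    HasDerivAt (fun x => ellWeight τ x ^ 2) (-(2 * x / (1 + τ)) * ellWeight τ x ^ 2) x :=
  ((hasDerivAt_ellWeight hτ x).fun_pow 2).congr_deriv (by push_cast; ring)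

theorem hasDerivAt_R1 (hτ : 0 ≤ τ) (n : ℕ) (x : ℝ) :
    HasDerivAt (R1 τ (n + 2)) (-2 * ((√(2 * π) * (1 + τ) * n.factorial)⁻¹ *
      (ellWeight τ x ^ 2 * CH τ (n + 1) x * CH τ n x))) x := by
  have hR : R1 τ (n + 2) = fun x => (√(2 * π))⁻¹ * (ellWeight τ x ^ 2
      * ∑ k ∈ range (n + 1), CH τ k x ^ 2 / k.factorial) := by
    funext x
    rw [R1, ← ellWeight_sq, div_eq_inv_mul, mul_assoc]
    rfl
  have hsum : HasDerivAt (fun x => ∑ k ∈ range (n + 1), CH τ k x ^ 2 / (k.factorial : ℝ))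
      (2 * ∑ k ∈ range (n + 1), CH τ k x * (k * CH τ (k - 1) x) / k.factorial) x := by
    rw [mul_sum]
    refine HasDerivAt.fun_sum fun k _ => ?_
    refine (((hasDerivAt_CH τ k x).fun_pow 2).div_const (k.factorial : ℝ)).congr_deriv ?_
    push_cast
    ring
  rw [hR]
  refine (((hasDerivAt_ellWeight_sq hτ x).fun_mul hsum).const_mul _).congr_deriv ?_
  have h := sum_CH_sq_sub τ x n
  have hs : 1 + τ ≠ 0 := by positivity
  field_simp
  field_simp at h
  linear_combination -ellWeight τ x ^ 2 * h

theorem R2_add_two (τ : ℝ) (n : ℕ) : R2 τ (n + 2) = fun x =>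
    (√(2 * π) * (1 + τ) * n.factorial)⁻¹
      * (ellWeight τ x * CH τ (n + 1) x * ellPrimitive τ n x) := by
  funext x
  simp only [R2, ellPrimitive, ellWeight, Nat.add_sub_cancel, Nat.reduceSubDiff]
  rw [mul_inv, mul_inv, one_div, mul_inv]
  ring

/-- The moment series of a closed first-order system satisfy the equation with coefficients
`A_k`. -/
theorem sum_Apoly_mul_iterate_derivative_momentSeries (hτ : 0 ≤ τ) (Nr : ℝ)
    {U F G H V W : ℝ → ℝ} (mU : HasMoments U) (mF : HasMoments F) (mG : HasMoments G)
    (mH : HasMoments H) (mV : HasMoments V) (mW : HasMoments W)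
    (dU : ∀ x, HasDerivAt U ((-2) * G x) x)
    (dF : ∀ x, HasDerivAt F (-(2 / (1 + τ)) * (x * F x) + 2 * (Nr - 1) * G x) x)
    (dG : ∀ x, HasDerivAt (fun x => τ * G x) ((1 - τ) / (1 + τ) * (x * G x)
      + (τ * (Nr - 1) * H x + (-1) * F x)) x)
    (dH : ∀ x, HasDerivAt (fun x => τ * H x) (2 / (1 + τ) * (x * H x) + (-2) * G x) x)
    (dV : ∀ x, HasDerivAt V (-(1 / (1 + τ)) * (x * V x) + ((Nr - 1) * W x + G x)) x)
    (dW : ∀ x, HasDerivAt (fun x => τ * W x) (1 / (1 + τ) * (x * W x)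
      + (τ * H x + (-1) * V x)) x) :
    ∑ k ∈ range 8, (Apoly τ Nr k : PowerSeries ℝ) * (PowerSeries.derivative ℝ)^[k]
      (momentSeries U + momentSeries V) = 0 := by
  have hs : 1 + τ ≠ 0 := by positivity
  have sU := momentSeries_deriv mU (mG.const_mul _) dU
  have sF := momentSeries_deriv mF ((mF.id_mul.const_mul _).add (mG.const_mul _)) dF
  have sG := momentSeries_deriv (mG.const_mul _) ((mG.id_mul.const_mul _).add
    ((mH.const_mul _).add (mF.const_mul _))) dG
  have sH := momentSeries_deriv (mH.const_mul _) ((mH.id_mul.const_mul _).add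
    (mG.const_mul _)) dH
  have sV := momentSeries_deriv mV ((mV.id_mul.const_mul _).add ((mW.const_mul _).add mG)) dV
  have sW := momentSeries_deriv (mW.const_mul _) ((mW.id_mul.const_mul _).add
    ((mH.const_mul _).add (mV.const_mul _))) dW
  rw [momentSeries_const_mul] at sU
  rw [momentSeries_add (mF.id_mul.const_mul _) (mG.const_mul _), momentSeries_const_mul,
    momentSeries_const_mul, momentSeries_id_mul] at sF
  rw [momentSeries_add (mG.id_mul.const_mul _) ((mH.const_mul _).add (mF.const_mul _)),
    momentSeries_add (mH.const_mul _) (mF.const_mul _), momentSeries_const_mul,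
    momentSeries_const_mul, momentSeries_const_mul, momentSeries_const_mul,
    momentSeries_id_mul] at sG
  rw [momentSeries_add (mH.id_mul.const_mul _) (mG.const_mul _), momentSeries_const_mul,
    momentSeries_const_mul, momentSeries_const_mul, momentSeries_id_mul] at sH
  rw [momentSeries_add (mV.id_mul.const_mul _) ((mW.const_mul _).add mG),
    momentSeries_add (mW.const_mul _) mG, momentSeries_const_mul,
    momentSeries_const_mul, momentSeries_id_mul] at sV
  rw [momentSeries_add (mW.id_mul.const_mul _) ((mH.const_mul _).add (mV.const_mul _)),
    momentSeries_add (mH.const_mul _) (mV.const_mul _), momentSeries_const_mul,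
    momentSeries_const_mul, momentSeries_const_mul, momentSeries_const_mul,
    momentSeries_id_mul] at sW
  have hinv : (1 + PowerSeries.C τ) * PowerSeries.C (1 + τ)⁻¹ = 1 := by
    rw [← map_one PowerSeries.C, ← map_add, ← map_mul, mul_inv_cancel₀ hs]
  have hGU : 2 * momentSeries G = PowerSeries.X * momentSeries U := by
    rw [map_neg, map_ofNat] at sU
    linear_combination -sU
  have hGU' : 2 * PowerSeries.derivative ℝ (momentSeries G) = momentSeries U
      + PowerSeries.X * PowerSeries.derivative ℝ (momentSeries U) := by
    rw [two_mul, ← map_add, ← two_mul, hGU, Derivation.leibniz, PowerSeries.derivative_X,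
      smul_eq_mul, smul_eq_mul, mul_one, add_comm]
  simp only [div_eq_mul_inv, map_neg, map_mul, map_sub, map_one, map_ofNat]
    at sF sG sH sV sW hinv
  refine sum_Apoly_mul_iterate_derivative τ _ (Y := momentSeries F) (Z := momentSeries H)
    (V₂ := momentSeries W) ?_ ?_ ?_ ?_ ?_
  · linear_combination -(1 + PowerSeries.C τ) * sF
      - 2 * PowerSeries.derivative ℝ (momentSeries F) * hinv
      + (1 + PowerSeries.C τ) * (PowerSeries.C Nr - 1) * hGU
  · linear_combination 2 * (1 + PowerSeries.C τ) * sG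
      - 2 * (1 - PowerSeries.C τ) * PowerSeries.derivative ℝ (momentSeries G) * hinv
      - (1 - PowerSeries.C τ) * hGU'
      - (1 + PowerSeries.C τ) * PowerSeries.C τ * PowerSeries.X * hGU
  · linear_combination (1 + PowerSeries.C τ) * sH
      - 2 * PowerSeries.derivative ℝ (momentSeries H) * hinv + (1 + PowerSeries.C τ) * hGU
  · linear_combination -2 * (1 + PowerSeries.C τ) * sV
      - 2 * PowerSeries.derivative ℝ (momentSeries V) * hinv + (1 + PowerSeries.C τ) * hGU
  · linear_combination (1 + PowerSeries.C τ) * sW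
      - PowerSeries.derivative ℝ (momentSeries W) * hinv

theorem sum_Apoly_mul_iterate_derivative_R1_add_R2 (hτ : 0 ≤ τ) (n : ℕ) :
    ∑ k ∈ range 8, (Apoly τ (n + 2 : ℕ) k : PowerSeries ℝ) * (PowerSeries.derivative ℝ)^[k]
      (momentSeries (R1 τ (n + 2)) + momentSeries (R2 τ (n + 2))) = 0 := by
  have hs : 1 + τ ≠ 0 := by positivity
  obtain ⟨κ, hκ⟩ : ∃ κ : ℝ, κ = (√(2 * π) * (1 + τ) * n.factorial)⁻¹ := ⟨_, rfl⟩
  let F : ℝ → ℝ := fun x => κ * (ellWeight τ x ^ 2 * CH τ (n + 1) x * CH τ (n + 1) x)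
  let G : ℝ → ℝ := fun x => κ * (ellWeight τ x ^ 2 * CH τ (n + 1) x * CH τ n x)
  let H : ℝ → ℝ := fun x => κ * (ellWeight τ x ^ 2 * CH τ n x * CH τ n x)
  let V : ℝ → ℝ := fun x => κ * (ellWeight τ x * CH τ (n + 1) x * ellPrimitive τ n x)
  let W : ℝ → ℝ := fun x => κ * (ellWeight τ x * CH τ n x * ellPrimitive τ n x)
  have mF : HasMoments F := (HasMoments.ellWeight_sq_mul hτ _ _).const_mul κ
  have mG : HasMoments G := (HasMoments.ellWeight_sq_mul hτ _ _).const_mul κ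
  have mH : HasMoments H := (HasMoments.ellWeight_sq_mul hτ _ _).const_mul κ
  have mV : HasMoments V := (HasMoments.ellWeight_mul_ellPrimitive hτ _ _).const_mul κ
  have mW : HasMoments W := (HasMoments.ellWeight_mul_ellPrimitive hτ _ _).const_mul κ
  have hf : ∀ x, HasDerivAt (CH τ (n + 1)) (((n : ℝ) + 1) * CH τ n x) x := fun x => by
    simpa using hasDerivAt_CH τ (n + 1) x
  have hg := hasDerivAt_CH τ n
  have hl := fun x => CH_lowering τ x n
  have he := hasDerivAt_ellWeight hτ
  have he2 := hasDerivAt_ellWeight_sq hτ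
  have hE := hasDerivAt_ellPrimitive τ n
  have hN : ((n + 2 : ℕ) : ℝ) - 1 = n + 1 := by push_cast; ring
  rw [R2_add_two, ← hκ]
  refine sum_Apoly_mul_iterate_derivative_momentSeries hτ _ (hasMoments_R1 hτ n) mF mG mH mV mW
    (fun x => ?_) (fun x => ?_) (fun x => ?_) (fun x => ?_) (fun x => ?_) (fun x => ?_)
  · simpa only [G, hκ] using hasDerivAt_R1 hτ n x
  · refine ((((he2 x).fun_mul (hf x)).fun_mul (hf x)).const_mul κ).congr_deriv ?_
    simp only [F, G, hN]
    ring
  · refine (((((he2 x).fun_mul (hf x)).fun_mul (hg x)).const_mul κ).const_mul τ).congr_deriv ?_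
    simp only [F, G, H, hN]
    field_simp
    linear_combination κ * (1 + τ) * ellWeight τ x ^ 2 * CH τ (n + 1) x * hl x
  · refine (((((he2 x).fun_mul (hg x)).fun_mul (hg x)).const_mul κ).const_mul τ).congr_deriv ?_
    simp only [G, H]
    field_simp
    linear_combination 2 * κ * (1 + τ) * ellWeight τ x ^ 2 * CH τ n x * hl x
  · refine ((((he x).fun_mul (hf x)).fun_mul (hE x)).const_mul κ).congr_deriv ?_
    simp only [W, G, hN]
    ring
  · refine (((((he x).fun_mul (hg x)).fun_mul (hE x)).const_mul κ).const_mul τ).congr_deriv ?_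
    simp only [W, H]
    field_simp
    linear_combination κ * (1 + τ) * ellWeight τ x * ellPrimitive τ n x * hl x

theorem egf_Mom (hτ : 0 ≤ τ) (n : ℕ) :
    egf (Mom τ (n + 2)) = momentSeries (R1 τ (n + 2)) + momentSeries (R2 τ (n + 2)) := by
  refine Eq.trans ?_ (momentSeries_add (hasMoments_R1 hτ n) ?_)
  · rfl
  · rw [R2_add_two]
    exact (HasMoments.ellWeight_mul_ellPrimitive hτ _ _).const_mul _

end EllipticDensity

/-- **Theorem (Harer–Zagier type recursion formula for the elliptic GinOE).**
For every `τ ∈ [0,1]`, every even integer `N ≥ 2` and every integer `p ≥ 10`,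
`2(2p+1)(1−τ)⁶·M_{2p,τ} = Σ_{l=1}^{10} 𝔄_l(p;τ)·M_{2p−2l,τ}`. -/
theorem elliptic_GinOE_recursion (τ : ℝ) (hτ : τ ∈ Set.Icc (0:ℝ) 1)
    (N : ℕ) (hNeven : Even N) (hN2 : 2 ≤ N) (p : ℕ) (hp : 10 ≤ p) :
    2*(2*(p:ℝ)+1)*(1-τ)^6 * Mom τ N (2*p)
      = ∑ l ∈ Finset.Icc 1 10, frakA τ (N : ℝ) p l * Mom τ N (2*p - 2*l) := by
  obtain ⟨n, rfl⟩ := Nat.exists_eq_add_of_le' hN2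
  refine recurrence_of_sum_Apoly hτ (Nat.cast_nonneg _) hp ?_
  rw [egf_Mom hτ.1]
  exact sum_Apoly_mul_iterate_derivative_R1_add_R2 hτ.1 n
end

section
/- (GinOE case, τ = 0.) For every even integer N ≥ 2 and every integer p ≥ 2, the spectral moments satisfy the 3-term recurrence 2(2p+1)·M_{2p,0} = (2p−1)(6p+4N−5)·M_{2p−2,0} − (2p−3)(2p+N−4)(2p+2N−3)·M_{2p−4,0}. -/
open Real MeasureTheory Finset

/-- At `τ = 0` the polynomials `C_k` are the monomials. -/
lemma CH_zero_eq_pow (k : ℕ) (x : ℝ) : CH 0 k x = x ^ k := by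
  induction k using Nat.strong_induction_on with
  | _ k ih =>
    match k with
    | 0 => simp [CH]
    | 1 => simp [CH]
    | k + 2 =>
      simp only [CH, ih (k + 1) (by omega)]
      ring

lemma integrable_pow_mul_exp_neg_mul_sq {b : ℝ} (hb : 0 < b) (n : ℕ) :
    Integrable fun x : ℝ => x ^ n * exp (-b * x ^ 2) := by
  have h := integrable_rpow_mul_exp_neg_mul_sq hb (s := (n : ℝ))
    (by linarith [n.cast_nonneg (α := ℝ)])
  simpa only [rpow_natCast] using h

lemma integrable_pow_mul_exp_neg_sq (n : ℕ) :
    Integrable fun x : ℝ => x ^ n * exp (-x ^ 2) := by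
  simpa using integrable_pow_mul_exp_neg_mul_sq one_pos n

/-- The integral of `x ^ n * exp (-x ^ 2)` over the real line. -/
noncomputable def gaussMoment (n : ℕ) : ℝ := ∫ x : ℝ, x ^ n * exp (-x ^ 2)

lemma gaussMoment_add_two (n : ℕ) :
    2 * gaussMoment (n + 2) = (n + 1) * gaussMoment n := by
  have hd : ∀ x : ℝ, HasDerivAt (fun x : ℝ => x ^ (n + 1) * exp (-x ^ 2))
      ((n + 1) * (x ^ n * exp (-x ^ 2)) - 2 * (x ^ (n + 2) * exp (-x ^ 2))) x := by
    intro x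
    refine ((hasDerivAt_pow (n + 1) x).mul ((hasDerivAt_pow 2 x).fun_neg.exp)).congr_deriv ?_
    push_cast
    ring
  have h1 := (integrable_pow_mul_exp_neg_sq n).const_mul ((n : ℝ) + 1)
  have h2 := (integrable_pow_mul_exp_neg_sq (n + 2)).const_mul 2
  have h := integral_eq_zero_of_hasDerivAt_of_integrable hd (h1.sub h2)
    (integrable_pow_mul_exp_neg_sq (n + 1))
  rw [integral_sub h1 h2, integral_const_mul, integral_const_mul] at h
  unfold gaussMoment
  linarith

/-- The part of the density coming from the truncated exponential series, unnormalised. -/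
noncomputable def truncExpDensity (m : ℕ) (x : ℝ) : ℝ :=
  exp (-x ^ 2) * ∑ k ∈ range (m + 1), (x ^ k) ^ 2 / (k.factorial : ℝ)

lemma hasDerivAt_truncExpDensity (m : ℕ) (x : ℝ) :
    HasDerivAt (truncExpDensity m) (-2 / m.factorial * (x ^ (2 * m + 1) * exp (-x ^ 2))) x := by
  have he : HasDerivAt (fun x : ℝ => exp (-x ^ 2)) (-(2 * x) * exp (-x ^ 2)) x := by
    refine (hasDerivAt_pow 2 x).fun_neg.exp.congr_deriv ?_
    push_cast
    ring
  unfold truncExpDensity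
  induction m with
  | zero =>
    simp only [zero_add, sum_range_one, pow_zero, Nat.factorial_zero, Nat.cast_one, one_pow,
      div_one, mul_one]
    refine he.congr_deriv ?_
    ring
  | succ m ih =>
    simp_rw [sum_range_succ _ (m + 1), mul_add]
    have hp : HasDerivAt (fun x : ℝ => (x ^ (m + 1)) ^ 2 / ((m + 1).factorial : ℝ))
        (2 * (m + 1) * x ^ (2 * m + 1) / ((m + 1).factorial : ℝ)) x := by
      simp_rw [← pow_mul]
      refine ((hasDerivAt_pow ((m + 1) * 2) x).div_const _).congr_deriv ?_
      rw [show (m + 1) * 2 - 1 = 2 * m + 1 by omega]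
      push_cast
      ring
    refine (ih.add (he.mul hp)).congr_deriv ?_
    have hm : (m.factorial : ℝ) ≠ 0 := by positivity
    rw [Nat.factorial_succ]
    push_cast
    field_simp
    ring

lemma integrable_pow_mul_truncExpDensity (m n : ℕ) :
    Integrable fun x : ℝ => x ^ n * truncExpDensity m x := by
  simp_rw [truncExpDensity, mul_sum]
  refine integrable_finsetSum _ fun k _ => ?_
  refine ((integrable_pow_mul_exp_neg_sq (n + k * 2)).div_const (k.factorial : ℝ)).congr
    (ae_of_all _ fun x => ?_)
  ring

/-- Moments of the truncated exponential density in terms of Gaussian moments. -/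
lemma integral_pow_mul_truncExpDensity (m n : ℕ) :
    (n + 1) * ∫ x : ℝ, x ^ n * truncExpDensity m x
      = 2 / m.factorial * gaussMoment (n + 2 * m + 2) := by
  have hd : ∀ x : ℝ, HasDerivAt (fun x : ℝ => x ^ (n + 1) * truncExpDensity m x)
      ((n + 1) * (x ^ n * truncExpDensity m x)
        - 2 / m.factorial * (x ^ (n + 2 * m + 2) * exp (-x ^ 2))) x := by
    intro x
    refine ((hasDerivAt_pow (n + 1) x).mul (hasDerivAt_truncExpDensity m x)).congr_deriv ?_
    push_cast
    ring
  have h1 := (integrable_pow_mul_truncExpDensity m n).const_mul ((n : ℝ) + 1)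
  have h2 := (integrable_pow_mul_exp_neg_sq (n + 2 * m + 2)).const_mul (2 / (m.factorial : ℝ))
  have h := integral_eq_zero_of_hasDerivAt_of_integrable hd (h1.sub h2)
    (integrable_pow_mul_truncExpDensity m (n + 1))
  rw [integral_sub h1 h2, integral_const_mul, integral_const_mul] at h
  unfold gaussMoment
  linarith

/-- The incomplete Gaussian moment integral from `0` to `x`. -/
noncomputable def incompleteGauss (m : ℕ) (x : ℝ) : ℝ :=
  ∫ u in (0 : ℝ)..x, exp (-u ^ 2 / 2) * u ^ m

lemma hasDerivAt_incompleteGauss (m : ℕ) (x : ℝ) :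
    HasDerivAt (incompleteGauss m) (exp (-x ^ 2 / 2) * x ^ m) x :=
  intervalIntegral.integral_hasDerivAt_right (Continuous.intervalIntegrable (by fun_prop) _ _)
    (Continuous.stronglyMeasurableAtFilter (by fun_prop) _ _)
    (Continuous.continuousAt (by fun_prop))

lemma abs_incompleteGauss_le (m : ℕ) (x : ℝ) : |incompleteGauss m x| ≤ |x ^ (m + 1)| := by
  have h : ∀ u ∈ Set.uIoc (0 : ℝ) x, ‖exp (-u ^ 2 / 2) * u ^ m‖ ≤ |x| ^ m := by
    intro u hu
    have hux : |u| ≤ |x| := by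
      rcases Set.mem_uIoc.1 hu with h | h
      · rw [abs_of_pos h.1, abs_of_pos (h.1.trans_le h.2)]
        exact h.2
      · rw [abs_of_nonpos h.2, abs_of_neg (h.1.trans_le h.2)]
        linarith [h.1]
    rw [norm_mul, norm_pow, norm_eq_abs, norm_eq_abs, abs_exp]
    have he : exp (-u ^ 2 / 2) ≤ 1 := exp_le_one_iff.2 (by nlinarith [sq_nonneg u])
    calc exp (-u ^ 2 / 2) * |u| ^ m ≤ 1 * |x| ^ m := by gcongr
      _ = |x| ^ m := one_mul _
  have := intervalIntegral.norm_integral_le_of_norm_le_const h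
  rwa [sub_zero, ← pow_succ, norm_eq_abs, ← abs_pow] at this

/-- The integrand of the moments of the correction term, unnormalised. -/
noncomputable def correctionIntegrand (m n : ℕ) (x : ℝ) : ℝ :=
  x ^ n * exp (-x ^ 2 / 2) * incompleteGauss m x

lemma integrable_correctionIntegrand (m n : ℕ) : Integrable (correctionIntegrand m n) := by
  have hc : Continuous (incompleteGauss m) :=
    continuous_iff_continuousAt.2 fun x => (hasDerivAt_incompleteGauss m x).continuousAt
  refine (integrable_pow_mul_exp_neg_mul_sq one_half_pos (n + (m + 1))).mono
    (by unfold correctionIntegrand; fun_prop) (ae_of_all _ fun x => ?_)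
  rw [correctionIntegrand, norm_mul, show x ^ (n + (m + 1)) * exp (-(1 / 2) * x ^ 2)
    = x ^ n * exp (-x ^ 2 / 2) * x ^ (m + 1) by ring_nf, norm_mul _ (x ^ (m + 1))]
  gcongr
  exact abs_incompleteGauss_le m x

lemma integral_correctionIntegrand_add_two (m n : ℕ) :
    ∫ x, correctionIntegrand m (n + 2) x
      = (n + 1) * (∫ x, correctionIntegrand m n x) + gaussMoment (n + m + 1) := by
  have hd : ∀ x : ℝ, HasDerivAt (correctionIntegrand m (n + 1))
      ((n + 1) * correctionIntegrand m n x + x ^ (n + m + 1) * exp (-x ^ 2)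
        - correctionIntegrand m (n + 2) x) x := by
    intro x
    have he := ((hasDerivAt_pow 2 x).fun_neg.div_const 2).exp
    have hx : exp (-x ^ 2) = exp (-x ^ 2 / 2) * exp (-x ^ 2 / 2) := by
      rw [← exp_add]
      ring_nf
    refine (((hasDerivAt_pow (n + 1) x).mul he).mul
      (hasDerivAt_incompleteGauss m x)).congr_deriv ?_
    simp only [correctionIntegrand, hx, Nat.add_sub_cancel, Pi.mul_apply]
    push_cast
    ring
  have h1 := (integrable_correctionIntegrand m n).const_mul ((n : ℝ) + 1)
  have h2 := integrable_pow_mul_exp_neg_sq (n + m + 1)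
  have h3 := integrable_correctionIntegrand m (n + 2)
  have h := integral_eq_zero_of_hasDerivAt_of_integrable hd ((h1.fun_add h2).sub h3)
    (integrable_correctionIntegrand m (n + 1))
  rw [integral_sub (h1.fun_add h2) h3, integral_add h1 h2, integral_const_mul] at h
  unfold gaussMoment
  linarith

lemma Mom_zero_eq (m n : ℕ) :
    Mom 0 (m + 2) n = (√(2 * π))⁻¹ * ((∫ x : ℝ, x ^ n * truncExpDensity m x)
      + (m.factorial : ℝ)⁻¹ * ∫ x, correctionIntegrand m (n + m + 1) x) := by
  rw [← integral_const_mul, ← integral_add (integrable_pow_mul_truncExpDensity m n)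
    ((integrable_correctionIntegrand m _).const_mul _), ← integral_const_mul, Mom]
  congr 1 with x
  simp only [Rd, R1, R2, CH_zero_eq_pow, truncExpDensity, correctionIntegrand, incompleteGauss,
    add_zero, div_one, mul_one, one_mul, Nat.add_sub_cancel, show m + 2 - 1 = m + 1 by omega]
  ring

/-- **Theorem (Recursion formula for real eigenvalues of the GinOE, `τ = 0`).**
For every even integer `N ≥ 2` and every integer `p ≥ 2`,
`2(2p+1)·M_{2p,0} = (2p−1)(6p+4N−5)·M_{2p−2,0} − (2p−3)(2p+N−4)(2p+2N−3)·M_{2p−4,0}`. -/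
theorem GinOE_three_term_recursion (N : ℕ) (hNeven : Even N) (hN2 : 2 ≤ N)
    (p : ℕ) (hp : 2 ≤ p) :
    2*(2*(p:ℝ)+1) * Mom 0 N (2*p)
      = (2*(p:ℝ)-1)*(6*(p:ℝ)+4*(N:ℝ)-5) * Mom 0 N (2*p-2)
        - (2*(p:ℝ)-3)*(2*(p:ℝ)+(N:ℝ)-4)*(2*(p:ℝ)+2*(N:ℝ)-3) * Mom 0 N (2*p-4) := by
  obtain ⟨m, rfl⟩ := Nat.exists_eq_add_of_le' hN2
  obtain ⟨q, rfl⟩ := Nat.exists_eq_add_of_le' hp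
  rw [show 2 * (q + 2) - 2 = 2 * q + 2 by omega, show 2 * (q + 2) - 4 = 2 * q by omega,
    show 2 * (q + 2) = 2 * q + 4 by ring]
  simp only [Mom_zero_eq]
  have a0 := integral_pow_mul_truncExpDensity m (2 * q)
  have a1 := integral_pow_mul_truncExpDensity m (2 * q + 2)
  have a2 := integral_pow_mul_truncExpDensity m (2 * q + 4)
  have b1 := integral_correctionIntegrand_add_two m (2 * q + m + 1)
  have b2 := integral_correctionIntegrand_add_two m (2 * q + m + 3)
  have g1 := gaussMoment_add_two (2 * q + 2 * m + 2)
  have g2 := gaussMoment_add_two (2 * q + 2 * m + 4)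
  rw [show 2 * q + 2 + 2 * m + 2 = 2 * q + 2 * m + 2 + 2 by ring] at a1
  rw [show 2 * q + 4 + 2 * m + 2 = 2 * q + 2 * m + 4 + 2 by ring] at a2
  rw [show 2 * q + m + 1 + m + 1 = 2 * q + 2 * m + 2 by ring] at b1
  rw [show 2 * q + m + 3 + m + 1 = 2 * q + 2 * m + 2 + 2 by ring] at b2
  rw [show 2 * q + 2 + m + 1 = 2 * q + m + 1 + 2 by ring,
    show 2 * q + 4 + m + 1 = 2 * q + m + 3 + 2 by ring, b2,
    show 2 * q + m + 3 = 2 * q + m + 1 + 2 by ring, b1]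
  rw [show 2 * q + 2 * m + 4 = 2 * q + 2 * m + 2 + 2 by ring] at g2 a2
  generalize gaussMoment (2 * q + 2 * m + 2 + 2 + 2) = G2 at *
  generalize gaussMoment (2 * q + 2 * m + 2 + 2) = G1 at *
  generalize gaussMoment (2 * q + 2 * m + 2) = G0 at *
  obtain rfl : G1 = (q + m + 3 / 2) * G0 := by push_cast at g1; linarith
  obtain rfl : G2 = (q + m + 5 / 2) * ((q + m + 3 / 2) * G0) := by push_cast at g2; linarith
  push_cast at a0 a1 a2 ⊢
  rw [div_eq_mul_inv] at a0 a1 a2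
  generalize ∫ x : ℝ, x ^ (2 * q) * truncExpDensity m x = A0 at *
  generalize ∫ x : ℝ, x ^ (2 * q + 2) * truncExpDensity m x = A1 at *
  generalize ∫ x : ℝ, x ^ (2 * q + 4) * truncExpDensity m x = A2 at *
  linear_combination (√(2 * π))⁻¹ * (2 * a2 - (6 * q + 4 * m + 15) * a1
    + (2 * q + m + 2) * (2 * q + 2 * m + 5) * a0)
end

section
/- (GOE case, τ = 1; Harer–Zagier type recursion of Ledoux.) For every even integer N ≥ 2 and every integer p ≥ 4, the spectral moments satisfy the 5-term recurrence (p+1)·M_{2p,1} = (4p−1)(2N−1)·M_{2p−2,1} + (2p−3)(10p²−9p−8N²+8N)·M_{2p−4,1} − 5(2p−3)(2p−4)(2p−5)(2N−1)·M_{2p−6,1} − 2(2p−3)(2p−4)(2p−5)(2p−6)(2p−7)·M_{2p−8,1}. -/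
open Real MeasureTheory Finset

/-- A function of temperate growth times a Gaussian is integrable. -/
lemma Function.HasTemperateGrowth.integrable_mul_exp_neg_mul_sq {g : ℝ → ℝ}
    (hg : g.HasTemperateGrowth) {b : ℝ} (hb : 0 < b) :
    Integrable fun x => g x * Real.exp (-b * x ^ 2) := by
  obtain ⟨k, C, hC⟩ := hg.2 0
  have hpow (j : ℕ) : Integrable fun x : ℝ => |x| ^ j * Real.exp (-b * x ^ 2) := by
    have h := (integrable_rpow_mul_exp_neg_mul_sq hb (s := j)
      (by have : (0 : ℝ) ≤ j := j.cast_nonneg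
          linarith)).norm
    simpa [Real.rpow_natCast, abs_mul, abs_pow] using h
  have hdom := ((hpow 0).add (hpow k)).const_mul (|C| * 2 ^ (k - 1))
  refine hdom.mono' (hg.1.continuous.mul (by fun_prop)).aestronglyMeasurable
    (Filter.Eventually.of_forall fun x => ?_)
  have hgx : |g x| ≤ |C| * (1 + |x|) ^ k := by
    have h := hC x
    rw [norm_iteratedFDeriv_zero] at h
    exact h.trans (by gcongr; exacts [le_abs_self C, le_rfl])
  have hadd : (1 + |x|) ^ k ≤ 2 ^ (k - 1) * (1 ^ k + |x| ^ k) :=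
    add_pow_le zero_le_one (abs_nonneg x) k
  calc ‖g x * Real.exp (-b * x ^ 2)‖ = |g x| * Real.exp (-b * x ^ 2) := by
        rw [norm_mul, Real.norm_eq_abs, Real.norm_eq_abs, Real.abs_exp]
    _ ≤ |C| * (2 ^ (k - 1) * (1 ^ k + |x| ^ k)) * Real.exp (-b * x ^ 2) := by
        gcongr
        exact hgx.trans (by gcongr)
    _ = _ := by simp; ring

/-- Two Gaussian-weighted functions of temperate growth, the second one multiplied by a bounded
continuous function, have an integrable sum. -/
lemma integrable_gaussian_add_gaussian_mul {u v J : ℝ → ℝ} (hu : u.HasTemperateGrowth)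
    (hv : v.HasTemperateGrowth) (hJ : Continuous J) {B : ℝ} (hB : ∀ x, |J x| ≤ B) :
    Integrable fun x => u x * Real.exp (-x ^ 2 / 4) ^ 2 + v x * (Real.exp (-x ^ 2 / 4) * J x) := by
  have h1 := hu.integrable_mul_exp_neg_mul_sq (b := 1 / 2) (by norm_num)
  have h2 := (hv.integrable_mul_exp_neg_mul_sq (b := 1 / 4) (by norm_num)).mul_bdd
    hJ.aestronglyMeasurable (Filter.Eventually.of_forall hB)
  refine (h1.add h2).congr (Filter.Eventually.of_forall fun x => ?_)
  have e1 : Real.exp (-x ^ 2 / 4) ^ 2 = Real.exp (-(1 / 2) * x ^ 2) := by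
    rw [← Real.exp_nat_mul]; congr 1; push_cast; ring
  have e2 : -x ^ 2 / 4 = -(1 / 4) * x ^ 2 := by ring
  simp only [Pi.add_apply]
  rw [e1, e2]
  ring

lemma CH_succ_succ (τ : ℝ) (k : ℕ) (x : ℝ) :
    CH τ (k + 2) x = x * CH τ (k + 1) x - ((k : ℝ) + 1) * τ * CH τ k x := by
  simp only [CH]

lemma CH_hasTemperateGrowth (τ : ℝ) : ∀ k, (CH τ k).HasTemperateGrowth
  | 0 => by unfold CH; fun_prop
  | 1 => by unfold CH; fun_prop
  | k + 2 => by
    have h0 := CH_hasTemperateGrowth τ k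
    have h1 := CH_hasTemperateGrowth τ (k + 1)
    unfold CH
    fun_prop

lemma hasDerivAt_CH_succ (τ : ℝ) (x : ℝ) :
    ∀ k : ℕ, HasDerivAt (CH τ (k + 1)) (((k : ℝ) + 1) * CH τ k x) x
  | 0 => by simpa [CH] using hasDerivAt_id' x
  | 1 => by
    have h := ((hasDerivAt_id' x).mul (hasDerivAt_id' x)).sub_const τ
    refine (h.congr_deriv ?_).congr_of_eventuallyEq (Filter.Eventually.of_forall fun y => ?_)
    · simp [CH]; ring
    · simp [CH]
  | k + 2 => by
    have h0 := hasDerivAt_CH_succ τ x k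
    have h1 := hasDerivAt_CH_succ τ x (k + 1)
    have h := ((hasDerivAt_id' x).mul h1).sub (h0.const_mul (((k + 1 : ℕ) + 1 : ℝ) * τ))
    refine (h.congr_deriv ?_).congr_of_eventuallyEq (Filter.Eventually.of_forall fun y => ?_)
    · have := CH_succ_succ τ k x
      push_cast
      linear_combination (-(k : ℝ) - 2) * this
    · simp [CH_succ_succ τ (k + 1)]

lemma hasDerivAt_CH_one (k : ℕ) (x : ℝ) :
    HasDerivAt (CH 1 k) (x * CH 1 k x - CH 1 (k + 1) x) x := by
  cases k with
  | zero => simpa [CH] using hasDerivAt_const x (1 : ℝ)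
  | succ k =>
    refine (hasDerivAt_CH_succ 1 x k).congr_deriv ?_
    linear_combination CH_succ_succ 1 k x

/-- The Christoffel–Darboux formula on the diagonal for the Hermite polynomials. -/
lemma sum_CH_one_sq_div_factorial (k : ℕ) (x : ℝ) :
    ∑ j ∈ Finset.range (k + 1), CH 1 j x ^ 2 / (j.factorial : ℝ) =
      (((k : ℝ) + 1) * CH 1 k x ^ 2 - x * CH 1 (k + 1) x * CH 1 k x + CH 1 (k + 1) x ^ 2) /
        (k.factorial : ℝ) := by
  induction k with
  | zero => simp [CH]; ring
  | succ k ih =>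
    rw [Finset.sum_range_succ, ih, CH_succ_succ, Nat.factorial_succ]
    have hk : (k.factorial : ℝ) ≠ 0 := by positivity
    have hk' : (k : ℝ) + 1 ≠ 0 := by positivity
    push_cast
    field_simp
    ring

/-- The Hermite function `e^{-x²/4} He_k(x)`. -/
noncomputable def hermiteFun (k : ℕ) (x : ℝ) : ℝ := Real.exp (-x ^ 2 / 4) * CH 1 k x

/-- The primitive of `hermiteFun k` that vanishes at the origin. -/
noncomputable def hermiteFunPrimitive (k : ℕ) (x : ℝ) : ℝ := ∫ u in (0 : ℝ)..x, hermiteFun k u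

lemma hasDerivAt_exp_neg_sq_div_four (x : ℝ) :
    HasDerivAt (fun y : ℝ => Real.exp (-y ^ 2 / 4)) (Real.exp (-x ^ 2 / 4) * (-x / 2)) x := by
  have h := (((hasDerivAt_id' x).pow 2).neg.div_const 4).exp
  refine h.congr_deriv ?_
  simp
  ring_nf

lemma hasDerivAt_hermiteFun_succ (k : ℕ) (x : ℝ) :
    HasDerivAt (hermiteFun (k + 1))
      (-x / 2 * hermiteFun (k + 1) x + ((k : ℝ) + 1) * hermiteFun k x) x := by
  refine ((hasDerivAt_exp_neg_sq_div_four x).mul (hasDerivAt_CH_succ 1 x k)).congr_deriv ?_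
  simp only [hermiteFun]
  ring

lemma hasDerivAt_hermiteFun (k : ℕ) (x : ℝ) :
    HasDerivAt (hermiteFun k) (x / 2 * hermiteFun k x - hermiteFun (k + 1) x) x := by
  refine ((hasDerivAt_exp_neg_sq_div_four x).mul (hasDerivAt_CH_one k x)).congr_deriv ?_
  simp only [hermiteFun]
  ring

lemma continuous_hermiteFun (k : ℕ) : Continuous (hermiteFun k) :=
  continuous_iff_continuousAt.2 fun x => (hasDerivAt_hermiteFun k x).continuousAt

lemma integrable_hermiteFun (k : ℕ) : Integrable (hermiteFun k) := by
  refine ((CH_hasTemperateGrowth 1 k).integrable_mul_exp_neg_mul_sq (b := 1 / 4)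
    (by norm_num)).congr (Filter.Eventually.of_forall fun x => ?_)
  simp only [hermiteFun]
  ring_nf

lemma hasDerivAt_hermiteFunPrimitive (k : ℕ) (x : ℝ) :
    HasDerivAt (hermiteFunPrimitive k) (hermiteFun k x) x :=
  (continuous_hermiteFun k).integral_hasStrictDerivAt 0 x |>.hasDerivAt

lemma continuous_hermiteFunPrimitive (k : ℕ) : Continuous (hermiteFunPrimitive k) :=
  continuous_iff_continuousAt.2 fun x => (hasDerivAt_hermiteFunPrimitive k x).continuousAt

lemma abs_hermiteFunPrimitive_le (k : ℕ) (x : ℝ) :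
    |hermiteFunPrimitive k x| ≤ ∫ u, ‖hermiteFun k u‖ :=
  (intervalIntegral.norm_integral_le_integral_norm_uIoc).trans
    (setIntegral_le_integral (integrable_hermiteFun k).norm
      (Filter.Eventually.of_forall fun _ => norm_nonneg _))

/-- The density in terms of Hermite functions, up to normalization. -/
noncomputable def hermiteDensity (k : ℕ) (x : ℝ) : ℝ :=
  ((k : ℝ) + 1) * hermiteFun k x ^ 2 - x * hermiteFun (k + 1) x * hermiteFun k x
    + hermiteFun (k + 1) x ^ 2 + hermiteFun (k + 1) x * hermiteFunPrimitive k x / 2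

lemma Rd_one_add_two (k : ℕ) (x : ℝ) :
    Rd 1 (k + 2) x = 1 / ((k.factorial : ℝ) * √(2 * π)) * hermiteDensity k x := by
  have e1 : Real.exp (-x ^ 2 / (1 + 1)) = Real.exp (-x ^ 2 / 4) ^ 2 := by
    rw [← Real.exp_nat_mul]; congr 1; push_cast; ring
  have e2 : (2 * (1 + 1) : ℝ) = 4 := by norm_num
  have hk : (k.factorial : ℝ) ≠ 0 := by positivity
  have hs : √(2 * π) ≠ 0 := by positivity
  simp only [Rd, R1, R2, show k + 2 - 1 = k + 1 from rfl, Nat.add_sub_cancel,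
    sum_CH_one_sq_div_factorial, e1, e2, hermiteDensity, hermiteFunPrimitive, hermiteFun]
  field_simp
  ring

lemma integrable_pow_mul_hermiteDensity (j k : ℕ) :
    Integrable fun x => x ^ j * hermiteDensity k x := by
  have h0 := CH_hasTemperateGrowth 1 k
  have h1 := CH_hasTemperateGrowth 1 (k + 1)
  refine (integrable_gaussian_add_gaussian_mul
    (u := fun x => x ^ j * (((k : ℝ) + 1) * CH 1 k x ^ 2 - x * CH 1 (k + 1) x * CH 1 k x
      + CH 1 (k + 1) x ^ 2))
    (v := fun x => x ^ j * (1 / 2 * CH 1 (k + 1) x)) (by fun_prop) (by fun_prop)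
    (continuous_hermiteFunPrimitive k) (abs_hermiteFunPrimitive_le k)).congr
    (Filter.Eventually.of_forall fun x => ?_)
  simp only [hermiteDensity, hermiteFun]
  ring

/-- The even polynomial `a x⁸ + b x⁶ + c x⁴ + d x² + e`. -/
def evenOctic (a b c d e x : ℝ) : ℝ := a * x ^ 8 + b * x ^ 6 + c * x ^ 4 + d * x ^ 2 + e

lemma hasDerivAt_evenOctic (a b c d e x : ℝ) :
    HasDerivAt (evenOctic a b c d e)
      (8 * a * x ^ 7 + 6 * b * x ^ 5 + 4 * c * x ^ 3 + 2 * d * x) x := by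
  have h (j : ℕ) := (hasDerivAt_id' x).pow j
  refine ((((((h 8).const_mul a).add ((h 6).const_mul b)).add ((h 4).const_mul c)).add
    ((h 2).const_mul d)).add_const e).congr_deriv ?_
  push_cast
  ring

/-- The coefficient of `φ ^ 2` in the bracket of `momentPrimitive`, where `φ = hermiteFun n`,
`ψ = hermiteFun (n - 1)` and `I` is the primitive of `ψ`. -/
noncomputable def coeffPhiSq (n m : ℝ) : ℝ → ℝ :=
  evenOctic (-1 / 2)
    (4 * n + 3)
    (5 / 2 * m ^ 2 + 35 * m - 8 * n ^ 2 - 12 * n + 237 / 2)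
    (-10 * n * m ^ 2 - 6 * m ^ 2 - 90 * n * m - 54 * m - 200 * n - 120)
    (-2 * m ^ 4 - 28 * m ^ 3 - 142 * m ^ 2 - 308 * m - 240)

/-- The coefficient of `x * φ * ψ` in the bracket of `momentPrimitive`, where `φ = hermiteFun n`,
`ψ = hermiteFun (n - 1)` and `I` is the primitive of `ψ`. -/
noncomputable def coeffPhiPsi (n m : ℝ) : ℝ → ℝ :=
  evenOctic (1 / 2)
    (-4 * n - 5 / 2)
    (-5 / 2 * m ^ 2 - 34 * m + 8 * n ^ 2 + 10 * n - 225 / 2)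
    (10 * n * m ^ 2 + 11 / 2 * m ^ 2 + 86 * n * m + 46 * m + 180 * n + 185 / 2)
    (2 * m ^ 4 + 27 * m ^ 3 + 130 * m ^ 2 + 261 * m + 180)

/-- The coefficient of `ψ ^ 2` in the bracket of `momentPrimitive`, where `φ = hermiteFun n`,
`ψ = hermiteFun (n - 1)` and `I` is the primitive of `ψ`. -/
noncomputable def coeffPsiSq (n m : ℝ) : ℝ → ℝ :=
  evenOctic (-1 / 2 * n)
    (4 * n ^ 2 + 2 * n)
    (5 / 2 * n * m ^ 2 + 35 * n * m - 8 * n ^ 3 - 8 * n ^ 2 + 247 / 2 * n)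
    (-10 * n ^ 2 * m ^ 2 - 5 * n * m ^ 2 - 90 * n ^ 2 * m - 45 * n * m - 200 * n ^ 2 - 100 * n)
    (-2 * n * m ^ 4 - 28 * n * m ^ 3 - 142 * n * m ^ 2 - 308 * n * m - 240 * n)

/-- The coefficient of `φ * I` in the bracket of `momentPrimitive`, where `φ = hermiteFun n`,
`ψ = hermiteFun (n - 1)` and `I` is the primitive of `ψ`. -/
noncomputable def coeffPhiInt (n m : ℝ) : ℝ → ℝ :=
  evenOctic 0
    (1 / 2 * m + 5)
    (m ^ 2 - 2 * n * m + 15 * m - 10 * n + 55)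
    (-1 / 2 * m ^ 3 - 4 * n * m ^ 2 - 8 * m ^ 2 - 36 * n * m - 83 / 2 * m - 80 * n - 70)
    (-m ^ 4 - 14 * m ^ 3 - 71 * m ^ 2 - 154 * m - 120)

/-- The coefficient of `x * ψ * I` in the bracket of `momentPrimitive`, where `φ = hermiteFun n`,
`ψ = hermiteFun (n - 1)` and `I` is the primitive of `ψ`. -/
noncomputable def coeffPsiInt (n m : ℝ) : ℝ → ℝ :=
  evenOctic 0
    0
    (-n * m - 10 * n)
    (4 * n ^ 2 * m + 2 * n * m + 20 * n ^ 2 + 10 * n)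
    (n * m ^ 3 + 12 * n * m ^ 2 + 47 * n * m + 60 * n)

/-- A primitive, decaying at infinity, of the combination of the functions `x ^ j * hermiteDensity`
that expresses the recursion for the moments. -/
noncomputable def momentPrimitive (k m : ℕ) (x : ℝ) : ℝ :=
  x ^ (m + 1) *
    (coeffPhiSq (k + 1) m x * hermiteFun (k + 1) x ^ 2
      + coeffPhiPsi (k + 1) m x * (x * hermiteFun (k + 1) x * hermiteFun k x)
      + coeffPsiSq (k + 1) m x * hermiteFun k x ^ 2
      + (coeffPhiInt (k + 1) m x * hermiteFun (k + 1) x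
        + coeffPsiInt (k + 1) m x * (x * hermiteFun k x)) * hermiteFunPrimitive k x)

lemma integrable_momentPrimitive (k m : ℕ) : Integrable (momentPrimitive k m) := by
  have h0 := CH_hasTemperateGrowth 1 k
  have h1 := CH_hasTemperateGrowth 1 (k + 1)
  refine (integrable_gaussian_add_gaussian_mul
    (u := fun x => x ^ (m + 1) * (coeffPhiSq (k + 1) m x * CH 1 (k + 1) x ^ 2
      + coeffPhiPsi (k + 1) m x * (x * CH 1 (k + 1) x * CH 1 k x)
      + coeffPsiSq (k + 1) m x * CH 1 k x ^ 2))
    (v := fun x => x ^ (m + 1) * (coeffPhiInt (k + 1) m x * CH 1 (k + 1) x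
      + coeffPsiInt (k + 1) m x * (x * CH 1 k x)))
    (by unfold coeffPhiSq coeffPhiPsi coeffPsiSq evenOctic; fun_prop)
    (by unfold coeffPhiInt coeffPsiInt evenOctic; fun_prop)
    (continuous_hermiteFunPrimitive k) (abs_hermiteFunPrimitive_le k)).congr
    (Filter.Eventually.of_forall fun x => ?_)
  simp only [momentPrimitive, hermiteFun]
  ring

/-- The recursion at the level of densities, with `N = k + 2` and `2 * p = m + 8`. -/
lemma hasDerivAt_momentPrimitive (k m : ℕ) (x : ℝ) :
    HasDerivAt (momentPrimitive k m)
      (-((m : ℝ) / 2 + 5) * (x ^ (m + 8) * hermiteDensity k x)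
        + (2 * (m : ℝ) + 15) * (2 * (k : ℝ) + 3) * (x ^ (m + 6) * hermiteDensity k x)
        + ((m : ℝ) + 5) * (5 / 2 * ((m : ℝ) + 8) ^ 2 - 9 / 2 * ((m : ℝ) + 8)
          - 8 * ((k : ℝ) + 2) ^ 2 + 8 * ((k : ℝ) + 2)) * (x ^ (m + 4) * hermiteDensity k x)
        - 5 * ((m : ℝ) + 5) * ((m : ℝ) + 4) * ((m : ℝ) + 3) * (2 * (k : ℝ) + 3)
          * (x ^ (m + 2) * hermiteDensity k x)
        - 2 * ((m : ℝ) + 5) * ((m : ℝ) + 4) * ((m : ℝ) + 3) * ((m : ℝ) + 2) * ((m : ℝ) + 1)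
          * (x ^ m * hermiteDensity k x)) x := by
  have hφ := hasDerivAt_hermiteFun_succ k x
  have hψ := hasDerivAt_hermiteFun k x
  have hI := hasDerivAt_hermiteFunPrimitive k x
  have hc (a b c d e : ℝ) := hasDerivAt_evenOctic a b c d e x
  have hx := hasDerivAt_id' x
  refine ((hx.pow (m + 1)).mul (((((hc _ _ _ _ _).mul (hφ.pow 2)).add
    ((hc _ _ _ _ _).mul ((hx.mul hφ).mul hψ))).add ((hc _ _ _ _ _).mul (hψ.pow 2))).add
    ((((hc _ _ _ _ _).mul hφ).add ((hc _ _ _ _ _).mul (hx.mul hψ))).mul hI))).congr_deriv ?_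
  simp only [Pi.add_apply, Pi.mul_apply, Pi.pow_apply, evenOctic, hermiteDensity,
    Nat.add_sub_cancel]
  push_cast
  ring

lemma Mom_one_add_two (k j : ℕ) :
    Mom 1 (k + 2) j =
      1 / ((k.factorial : ℝ) * √(2 * π)) * ∫ x, x ^ j * hermiteDensity k x := by
  rw [Mom, ← integral_const_mul]
  congr 1 with x
  rw [Rd_one_add_two]
  ring

/-- **Theorem (Harer–Zagier type recursion for the GOE, `τ = 1`; Ledoux).**
For every even integer `N ≥ 2` and every integer `p ≥ 4`,
`(p+1)·M_{2p,1} = (4p−1)(2N−1)·M_{2p−2,1} + (2p−3)(10p²−9p−8N²+8N)·M_{2p−4,1}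
 − 5(2p−3)(2p−4)(2p−5)(2N−1)·M_{2p−6,1} − 2(2p−3)(2p−4)(2p−5)(2p−6)(2p−7)·M_{2p−8,1}`. -/
theorem GOE_five_term_recursion (N : ℕ) (hNeven : Even N) (hN2 : 2 ≤ N)
    (p : ℕ) (hp : 4 ≤ p) :
    ((p:ℝ)+1) * Mom 1 N (2*p)
      = (4*(p:ℝ)-1)*(2*(N:ℝ)-1) * Mom 1 N (2*p-2)
        + (2*(p:ℝ)-3)*(10*(p:ℝ)^2-9*(p:ℝ)-8*(N:ℝ)^2+8*(N:ℝ)) * Mom 1 N (2*p-4)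
        - 5*(2*(p:ℝ)-3)*(2*(p:ℝ)-4)*(2*(p:ℝ)-5)*(2*(N:ℝ)-1) * Mom 1 N (2*p-6)
        - 2*(2*(p:ℝ)-3)*(2*(p:ℝ)-4)*(2*(p:ℝ)-5)*(2*(p:ℝ)-6)*(2*(p:ℝ)-7) * Mom 1 N (2*p-8) := by
  obtain ⟨k, rfl⟩ : ∃ k, N = k + 2 := ⟨N - 2, by omega⟩
  obtain ⟨q, rfl⟩ : ∃ q, p = q + 4 := ⟨p - 4, by omega⟩
  have hdens (j : ℕ) := integrable_pow_mul_hermiteDensity j k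
  have hfour (a b c d : ℝ) : Integrable fun x =>
      a * (x ^ (2 * q + 8) * hermiteDensity k x) + b * (x ^ (2 * q + 6) * hermiteDensity k x)
        + c * (x ^ (2 * q + 4) * hermiteDensity k x)
        - d * (x ^ (2 * q + 2) * hermiteDensity k x) :=
    ((((hdens _).const_mul a).add ((hdens _).const_mul b)).add ((hdens _).const_mul c)).sub
      ((hdens _).const_mul d)
  have hzero := integral_eq_zero_of_hasDerivAt_of_integrable
    (hasDerivAt_momentPrimitive k (2 * q)) ((hfour _ _ _ _).sub ((hdens _).const_mul _))
    (integrable_momentPrimitive k (2 * q))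
  rw [integral_sub (hfour _ _ _ _) ((hdens _).const_mul _),
    integral_sub ((((hdens _).const_mul _).fun_add ((hdens _).const_mul _)).fun_add
        ((hdens _).const_mul _)) ((hdens _).const_mul _),
    integral_add (((hdens _).const_mul _).fun_add ((hdens _).const_mul _)) ((hdens _).const_mul _),
    integral_add ((hdens _).const_mul _) ((hdens _).const_mul _)] at hzero
  simp only [integral_const_mul] at hzero
  rw [show 2 * (q + 4) = 2 * q + 8 by ring]
  simp only [Mom_one_add_two, show 2 * q + 8 - 2 = 2 * q + 6 from rfl,
    show 2 * q + 8 - 4 = 2 * q + 4 from rfl, show 2 * q + 8 - 6 = 2 * q + 2 from rfl,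
    Nat.add_sub_cancel]
  push_cast at hzero ⊢
  linear_combination (-1 / ((k.factorial : ℝ) * √(2 * π))) * hzero
end
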